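/- Let K and L be nonempty compact convex sets in ℝⁿ and let 1 ≤ i ≤ n be an integer. Then MV(K^{(i)}, L^{(n−i)})^n ≥ (n! · vol(K))^i · (n! · vol(L))^{n−i}. (Corollary 7.4(2).) -/

import Mathlib

open scoped Pointwise
open MeasureTheory Finset

/-- Lebesgue volume of a subset of ℝⁿ, as a real number. -/
noncomputable def vol {n : ℕ} (A : Set (Fin n → ℝ)) : ℝ := (volume A).toReal

/-- The mixed volume of `n` convex bodies in ℝⁿ, defined by the inclusion–exclusion
formula. -/
noncomputable def MV (n : ℕ) (K : Fin n → Set (Fin n → ℝ)) : ℝ :=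
  ∑ j ∈ Finset.Icc 1 n, (-1 : ℝ) ^ (n - j) *
    ∑ S ∈ Finset.univ.powersetCard j, vol (∑ i ∈ S, K i)

lemma MV_eq {n : ℕ} (hn : 1 ≤ n) (K : Fin n → Set (Fin n → ℝ)) :
    MV n K = ∑ S : Finset (Fin n), (-1 : ℝ) ^ (n - #S) * vol (∑ i ∈ S, K i) := by
  classical
  have h0 : vol (∑ i ∈ (∅ : Finset (Fin n)), K i) = 0 := by
    have : Nonempty (Fin n) := ⟨⟨0, hn⟩⟩
    rw [Finset.sum_empty, vol, ← Set.singleton_zero, measure_singleton]; rfl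
  have : (∑ S : Finset (Fin n), (-1 : ℝ) ^ (n - #S) * vol (∑ i ∈ S, K i))
      = ∑ j ∈ Finset.range (n + 1), ∑ S ∈ Finset.univ.powersetCard j,
        (-1 : ℝ) ^ (n - #S) * vol (∑ i ∈ S, K i) := by
    rw [← Finset.powerset_univ, Finset.sum_powerset, Finset.card_univ, Fintype.card_fin]
  rw [this, Finset.sum_range_succ', MV]
  simp only [Finset.powersetCard_zero, Finset.sum_singleton, h0, mul_zero, add_zero]
  rw [Finset.range_eq_Ico, Finset.sum_Ico_add' (fun j => ∑ S ∈ Finset.univ.powersetCard j,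
        (-1 : ℝ) ^ (n - #S) * vol (∑ i ∈ S, K i)) 0 n 1]
  have : Finset.Icc 1 n = Finset.Ico (0+1) (n+1) := by ext; simp
  rw [this]
  refine Finset.sum_congr rfl fun j _ => ?_
  rw [Finset.mul_sum]
  refine Finset.sum_congr rfl fun S hS => ?_
  rw [(Finset.mem_powersetCard.1 hS).2]

lemma incl_excl {n : ℕ} {α : Type*} [Fintype α] (c : α → Fin n)
    (F : (Fin n → α) → ℝ) :
    ∑ S : Finset (Fin n), (-1 : ℝ) ^ (n - #S) *
      (∑ f : Fin n → α, open Classical in if ∀ k, c (f k) ∈ S then F f else 0)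
    = ∑ f : Fin n → α, open Classical in if Function.Bijective (c ∘ f) then F f else 0 := by
  classical
  simp_rw [Finset.mul_sum]
  rw [Finset.sum_comm]
  refine Finset.sum_congr rfl fun f _ => ?_
  have key : ∑ S : Finset (Fin n), (-1 : ℝ) ^ (n - #S) * (if ∀ k, c (f k) ∈ S then (1:ℝ) else 0)
      = if Function.Bijective (c ∘ f) then 1 else 0 := by
    have e : ∑ S : Finset (Fin n), (-1 : ℝ) ^ (n - #S) * (if ∀ k, c (f k) ∈ S then (1:ℝ) else 0)
        = ∑ T ∈ (Finset.univ.image (c ∘ f))ᶜ.powerset, (-1 : ℝ) ^ #T := by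
      rw [← Finset.sum_filter_add_sum_filter_not _ (fun S => ∀ k, c (f k) ∈ S)]
      rw [Finset.sum_eq_zero (s := Finset.univ.filter (fun S => ¬ _)), add_zero]
      · refine Finset.sum_bij' (fun S _ => Sᶜ) (fun S _ => Sᶜ) ?_ ?_ ?_ ?_ ?_
        · intro S hS
          simp only [Finset.mem_filter, Finset.mem_univ, true_and] at hS
          rw [Finset.mem_powerset, Finset.compl_subset_compl]
          intro x hx
          obtain ⟨k, _, rfl⟩ := Finset.mem_image.1 hx
          exact hS k
        · intro S hS
          simp only [Finset.mem_filter, Finset.mem_univ, true_and]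
          intro k
          rw [Finset.mem_powerset] at hS
          rw [Finset.mem_compl]
          intro h
          exact Finset.mem_compl.1 (hS h) (Finset.mem_image_of_mem _ (Finset.mem_univ k))
        · simp
        · simp
        · intro S hS
          simp only [Finset.mem_filter, Finset.mem_univ, true_and] at hS
          simp [hS, Finset.card_compl]
      · intro S hS
        simp only [Finset.mem_filter, Finset.mem_univ, true_and] at hS
        rw [if_neg hS, mul_zero]
    rw [e]
    have := Finset.sum_powerset_neg_one_pow_card (x := (Finset.univ.image (c ∘ f))ᶜ)
    have h2 : ∑ T ∈ (Finset.univ.image (c ∘ f))ᶜ.powerset, (-1 : ℝ) ^ #T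
      = (((∑ T ∈ (Finset.univ.image (c ∘ f))ᶜ.powerset, (-1 : ℤ) ^ #T) : ℤ) : ℝ) := by
      push_cast; rfl
    rw [h2, this]
    have h3 : (Finset.univ.image (c ∘ f))ᶜ = ∅ ↔ Function.Bijective (c ∘ f) := by
      rw [Finset.compl_eq_empty_iff, Finset.eq_univ_iff_forall]
      constructor
      · intro h
        refine Finite.surjective_iff_bijective.1 fun y => ?_
        obtain ⟨k, _, hk⟩ := Finset.mem_image.1 (h y)
        exact ⟨k, hk⟩
      · intro h y
        obtain ⟨k, hk⟩ := h.2 y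
        exact Finset.mem_image.2 ⟨k, Finset.mem_univ _, hk⟩
    by_cases hb : Function.Bijective (c ∘ f)
    · rw [if_pos hb, if_pos (h3.2 hb)]; simp
    · rw [if_neg hb, if_neg (mt h3.1 hb)]; simp
  have : ∀ S : Finset (Fin n), (-1 : ℝ) ^ (n - #S) * (if ∀ k, c (f k) ∈ S then F f else 0)
      = ((-1 : ℝ) ^ (n - #S) * (if ∀ k, c (f k) ∈ S then (1:ℝ) else 0)) * F f := by
    intro S; split_ifs <;> simp
  simp_rw [this]
  rw [← Finset.sum_mul, key]
  split_ifs <;> simp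

lemma det_sum_rankone {n : ℕ} {α : Type*} [Fintype α] (a : α → ℝ) (u : α → Fin n → ℝ) :
    (∑ t, a t • Matrix.vecMulVec (u t) (u t)).det
    = (n.factorial : ℝ)⁻¹ * ∑ f : Fin n → α, (∏ k, a (f k)) *
      (Matrix.of fun k => u (f k)).det ^ 2 := by
  classical
  have h1 : (∑ t, a t • Matrix.vecMulVec (u t) (u t)).det
      = ∑ f : Fin n → α, (∏ k, a (f k)) * (∏ k, u (f k) k) *
        (Matrix.of fun k => u (f k)).det := by
    have : (∑ t, a t • Matrix.vecMulVec (u t) (u t))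
        = fun k => ∑ t, (a t * u t k) • u t := by
      ext k l
      simp [Matrix.sum_apply, Finset.sum_apply, Matrix.vecMulVec_apply, mul_assoc]
    rw [this]
    have h2 := (Matrix.detRowAlternating (R := ℝ) (n := Fin n)).toMultilinearMap.map_sum
      (fun k (t : α) => (a t * u t k) • u t)
    refine h2.trans (Finset.sum_congr rfl fun f _ => ?_)
    rw [MultilinearMap.map_smul_univ, Finset.prod_mul_distrib]
    rfl
  have h3 : ∀ σ : Equiv.Perm (Fin n), (∑ t, a t • Matrix.vecMulVec (u t) (u t)).det
      = ∑ f : Fin n → α, (∏ k, a (f k)) * ((Equiv.Perm.sign σ : ℤ) * (∏ k, u (f (σ k)) k)) *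
        (Matrix.of fun k => u (f k)).det := by
    intro σ
    rw [h1, ← Equiv.sum_comp (Equiv.arrowCongr σ.symm (Equiv.refl α))]
    refine Finset.sum_congr rfl fun f _ => ?_
    have e1 : ∏ k, a (((Equiv.arrowCongr σ.symm (Equiv.refl α)) f) k) = ∏ k, a (f k) := by
      simpa using Equiv.prod_comp σ (fun k => a (f k))
    have e2 : (Matrix.of fun k => u (((Equiv.arrowCongr σ.symm (Equiv.refl α)) f) k)).det
        = (Equiv.Perm.sign σ : ℤ) * (Matrix.of fun k => u (f k)).det := by
      have := Matrix.det_permute σ (Matrix.of fun k => u (f k))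
      simpa [Matrix.submatrix] using this
    rw [e1, e2]
    simp only [Equiv.arrowCongr_apply, Equiv.symm_symm, Function.comp, Equiv.refl_apply]
    ring
  have h4 : (n.factorial : ℝ) * (∑ t, a t • Matrix.vecMulVec (u t) (u t)).det
      = ∑ f : Fin n → α, (∏ k, a (f k)) * (Matrix.of fun k => u (f k)).det ^ 2 := by
    have : (n.factorial : ℝ) * (∑ t, a t • Matrix.vecMulVec (u t) (u t)).det
      = ∑ σ : Equiv.Perm (Fin n), (∑ t, a t • Matrix.vecMulVec (u t) (u t)).det := by
      simp [Fintype.card_perm]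
    rw [this, Finset.sum_congr rfl fun σ _ => h3 σ, Finset.sum_comm]
    refine Finset.sum_congr rfl fun f _ => ?_
    rw [← Finset.sum_mul, ← Finset.mul_sum, sq, mul_assoc]
    congr 2
    rw [Matrix.det_apply']
    simp
  rw [← h4, inv_mul_cancel_left₀]
  positivity

/-- mixed discriminant -/
noncomputable def mdisc {n : ℕ} {ι : Type*} [Fintype ι] (q : Fin n → ι → ℝ)
    (u : Fin n → ι → Fin n → ℝ) : ℝ :=
  (n.factorial : ℝ)⁻¹ * ∑ f : Fin n → Fin n × ι, open Classical in
    if Function.Bijective (Prod.fst ∘ f) then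
      (∏ k, q (f k).1 (f k).2) * (Matrix.of fun k => u (f k).1 (f k).2).det ^ 2 else 0

noncomputable def Hmat {n : ℕ} {ι : Type*} [Fintype ι] (q : Fin n → ι → ℝ)
    (u : Fin n → ι → Fin n → ℝ) (S : Finset (Fin n)) : Matrix (Fin n) (Fin n) ℝ :=
  ∑ j ∈ S, ∑ i, q j i • Matrix.vecMulVec (u j i) (u j i)

lemma det_Hmat {n : ℕ} {ι : Type*} [Fintype ι] (q : Fin n → ι → ℝ)
    (u : Fin n → ι → Fin n → ℝ) (S : Finset (Fin n)) :
    (Hmat q u S).det = (n.factorial : ℝ)⁻¹ * ∑ f : Fin n → Fin n × ι, open Classical in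
      if ∀ k, (f k).1 ∈ S then
      (∏ k, q (f k).1 (f k).2) * (Matrix.of fun k => u (f k).1 (f k).2).det ^ 2 else 0 := by
  classical
  have : Hmat q u S = ∑ t : Fin n × ι, (if t.1 ∈ S then q t.1 t.2 else 0) •
      Matrix.vecMulVec (u t.1 t.2) (u t.1 t.2) := by
    rw [Hmat, Fintype.sum_prod_type]
    simp only [ite_smul, zero_smul]
    rw [← Finset.sum_filter_add_sum_filter_not Finset.univ (fun j => j ∈ S)]
    rw [Finset.sum_eq_zero (s := Finset.univ.filter (fun S => ¬ _)), add_zero]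
    · rw [Finset.filter_mem_eq_inter, Finset.univ_inter]
      exact Finset.sum_congr rfl fun j hj => by simp [hj]
    · intro j hj
      simp only [Finset.mem_filter, Finset.mem_univ, true_and] at hj
      simp [hj]
  rw [this, det_sum_rankone]
  congr 1
  refine Finset.sum_congr rfl fun f _ => ?_
  split_ifs with h
  · congr 1
    exact Finset.prod_congr rfl fun k _ => by simp [h k]
  · push Not at h
    obtain ⟨k, hk⟩ := h
    rw [Finset.prod_eq_zero (Finset.mem_univ k) (by simp [hk]), zero_mul]

lemma mdisc_eq {n : ℕ} {ι : Type*} [Fintype ι] (q : Fin n → ι → ℝ)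
    (u : Fin n → ι → Fin n → ℝ) :
    ∑ S : Finset (Fin n), (-1 : ℝ) ^ (n - #S) * (Hmat q u S).det = mdisc q u := by
  rw [mdisc, ← incl_excl, Finset.mul_sum]
  refine Finset.sum_congr rfl fun S _ => ?_
  rw [det_Hmat]
  ring

lemma mdisc_nonneg {n : ℕ} {ι : Type*} [Fintype ι] (q : Fin n → ι → ℝ)
    (u : Fin n → ι → Fin n → ℝ) (hq : ∀ j i, 0 ≤ q j i) : 0 ≤ mdisc q u := by
  refine mul_nonneg (by positivity) (Finset.sum_nonneg fun f _ => ?_)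
  split_ifs
  · exact mul_nonneg (Finset.prod_nonneg fun k _ => hq _ _) (sq_nonneg _)
  · rfl

lemma det_Hmat_nonneg {n : ℕ} {ι : Type*} [Fintype ι] (q : Fin n → ι → ℝ)
    (u : Fin n → ι → Fin n → ℝ) (S : Finset (Fin n)) (hq : ∀ j i, 0 ≤ q j i) :
    0 ≤ (Hmat q u S).det := by
  rw [det_Hmat]
  refine mul_nonneg (by positivity) (Finset.sum_nonneg fun f _ => ?_)
  split_ifs
  · exact mul_nonneg (Finset.prod_nonneg fun k _ => hq _ _) (sq_nonneg _)
  · rfl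


section softmax
variable {n : ℕ} {ι : Type*} [Fintype ι]

noncomputable def dotL (v : Fin n → ℝ) : (Fin n → ℝ) →L[ℝ] ℝ :=
  ∑ k, v k • ContinuousLinearMap.proj (R := ℝ) (φ := fun _ : Fin n => ℝ) k

@[simp] lemma dotL_apply (v x : Fin n → ℝ) : dotL v x = v ⬝ᵥ x := by
  simp [dotL, dotProduct]

noncomputable def pz (p : ι → Fin n → ℝ) (w : ι → ℝ) (x : Fin n → ℝ) : ℝ :=
  ∑ i, w i * Real.exp (p i ⬝ᵥ x)

noncomputable def pq (p : ι → Fin n → ℝ) (w : ι → ℝ) (x : Fin n → ℝ) (i : ι) : ℝ :=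
  w i * Real.exp (p i ⬝ᵥ x) / pz p w x

noncomputable def pm (p : ι → Fin n → ℝ) (w : ι → ℝ) (x : Fin n → ℝ) : Fin n → ℝ :=
  ∑ i, pq p w x i • p i

lemma pz_pos (p : ι → Fin n → ℝ) {w : ι → ℝ} (hw : ∀ i, 0 ≤ w i) (hw' : ∃ i, 0 < w i)
    (x : Fin n → ℝ) : 0 < pz p w x := by
  obtain ⟨i, hi⟩ := hw'
  exact Finset.sum_pos' (fun i _ => mul_nonneg (hw i) (Real.exp_pos _).le)
    ⟨i, Finset.mem_univ _, mul_pos hi (Real.exp_pos _)⟩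

lemma pq_nonneg (p : ι → Fin n → ℝ) {w : ι → ℝ} (hw : ∀ i, 0 ≤ w i)
    (x : Fin n → ℝ) (i : ι) : 0 ≤ pq p w x i :=
  div_nonneg (mul_nonneg (hw i) (Real.exp_pos _).le)
    (Finset.sum_nonneg fun i _ => mul_nonneg (hw i) (Real.exp_pos _).le)

lemma pq_sum (p : ι → Fin n → ℝ) {w : ι → ℝ} (hw : ∀ i, 0 ≤ w i) (hw' : ∃ i, 0 < w i)
    (x : Fin n → ℝ) : ∑ i, pq p w x i = 1 := by
  simp only [pq]
  rw [← Finset.sum_div]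
  exact div_self (pz_pos p hw hw' x).ne'

lemma pm_dot (p : ι → Fin n → ℝ) (w : ι → ℝ) (x v : Fin n → ℝ) :
    pm p w x ⬝ᵥ v = ∑ i, pq p w x i * (p i ⬝ᵥ v) := by
  simp [pm, sum_dotProduct, smul_dotProduct]

lemma pz_hasFDerivAt (p : ι → Fin n → ℝ) (w : ι → ℝ) (x : Fin n → ℝ) :
    HasFDerivAt (pz p w) (∑ i, (w i * Real.exp (p i ⬝ᵥ x)) • dotL (p i)) x := by
  refine HasFDerivAt.fun_sum fun i _ => ?_
  have h := ((dotL (p i)).hasFDerivAt (x := x)).exp.const_mul (w i)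
  simp only [dotL_apply] at h
  rw [smul_smul] at h
  exact h

lemma sum_smul_dotL (p : ι → Fin n → ℝ) (w : ι → ℝ) (x : Fin n → ℝ) (hz : pz p w x ≠ 0) :
    ∑ i, (w i * Real.exp (p i ⬝ᵥ x)) • dotL (p i) = pz p w x • dotL (pm p w x) := by
  ext d
  simp only [_root_.sum_apply, smul_apply, dotL_apply, pm,
    sum_dotProduct, smul_dotProduct, smul_eq_mul, Finset.mul_sum, pq]
  refine Finset.sum_congr rfl fun i _ => ?_
  field_simp

lemma logpz_hasFDerivAt (p : ι → Fin n → ℝ) {w : ι → ℝ} (hw : ∀ i, 0 ≤ w i)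
    (hw' : ∃ i, 0 < w i) (x : Fin n → ℝ) :
    HasFDerivAt (fun x => Real.log (pz p w x)) (dotL (pm p w x)) x := by
  have hz := (pz_pos p hw hw' x).ne'
  have h := (pz_hasFDerivAt p w x).log hz
  rwa [sum_smul_dotL p w x hz, inv_smul_smul₀ hz] at h

lemma dotL_sub (a b : Fin n → ℝ) : dotL (a - b) = dotL a - dotL b := by
  ext d; simp [sub_dotProduct]

lemma pq_hasFDerivAt (p : ι → Fin n → ℝ) {w : ι → ℝ} (hw : ∀ i, 0 ≤ w i)
    (hw' : ∃ i, 0 < w i) (x : Fin n → ℝ) (i : ι) :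
    HasFDerivAt (fun x => pq p w x i) (pq p w x i • dotL (p i - pm p w x)) x := by
  have hz := (pz_pos p hw hw' x).ne'
  have h1 := ((dotL (p i)).hasFDerivAt (x := x)).exp.const_mul (w i)
  simp only [dotL_apply] at h1
  have h3 := pz_hasFDerivAt p w x
  rw [sum_smul_dotL p w x hz] at h3
  have h2 := h1.fun_mul ((hasDerivAt_inv hz).comp_hasFDerivAt x h3)
  simp only [Function.comp_apply, ← div_eq_mul_inv] at h2
  refine h2.congr_fderiv ?_
  ext d
  simp only [add_apply, smul_apply, dotL_apply,
    smul_eq_mul, pq, sub_dotProduct]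
  field_simp
  ring

lemma pm_hasFDerivAt (p : ι → Fin n → ℝ) {w : ι → ℝ} (hw : ∀ i, 0 ≤ w i)
    (hw' : ∃ i, 0 < w i) (x : Fin n → ℝ) :
    HasFDerivAt (pm p w) (LinearMap.toContinuousLinearMap (Matrix.toLin' (∑ i, pq p w x i •
      Matrix.vecMulVec (p i - pm p w x) (p i - pm p w x)))) x := by
  have h := HasFDerivAt.fun_sum (u := Finset.univ)
    fun i _ => (pq_hasFDerivAt p hw hw' x i).smul_const (p i)
  refine HasFDerivAt.congr_fderiv h ?_
  have e : ∀ d : Fin n → ℝ, ∑ i, pq p w x i * ((p i - pm p w x) ⬝ᵥ d) = 0 := by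
    intro d
    simp only [sub_dotProduct, mul_sub, Finset.sum_sub_distrib]
    rw [← Finset.sum_mul, pq_sum p hw hw', one_mul]
    rw [pm_dot, sub_self]
  ext d k
  simp only [_root_.sum_apply, ContinuousLinearMap.smulRight_apply,
    smul_apply, dotL_apply, smul_eq_mul, Finset.sum_apply, Pi.smul_apply,
    LinearMap.coe_toContinuousLinearMap', Matrix.toLin'_apply, Matrix.sum_mulVec,
    Matrix.smul_mulVec, Matrix.vecMulVec_mulVec]
  have : ∀ i, pq p w x i * ((p i - pm p w x) ⬝ᵥ d) * p i k
    = pq p w x i * ((p i - pm p w x) ⬝ᵥ d) * (p i - pm p w x) k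
     + pq p w x i * ((p i - pm p w x) ⬝ᵥ d) * pm p w x k := by
    intro i; simp only [Pi.sub_apply]; ring
  simp_rw [this]
  rw [Finset.sum_add_distrib, ← Finset.sum_mul, e, zero_mul, add_zero]
  refine Finset.sum_congr rfl fun i _ => ?_
  simp
  ring

noncomputable def FS (p : ι → Fin n → ℝ) (w : Fin n → ι → ℝ) (S : Finset (Fin n))
    (x : Fin n → ℝ) : Fin n → ℝ := ∑ j ∈ S, pm p (w j) x

/-- Hessian -/
noncomputable def HS (p : ι → Fin n → ℝ) (w : Fin n → ι → ℝ) (S : Finset (Fin n))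
    (x : Fin n → ℝ) : Matrix (Fin n) (Fin n) ℝ :=
  Hmat (fun j => pq p (w j) x) (fun j i => p i - pm p (w j) x) S

lemma FS_hasFDerivAt (p : ι → Fin n → ℝ) {w : Fin n → ι → ℝ} (hw : ∀ j i, 0 ≤ w j i)
    (hw' : ∀ j, ∃ i, 0 < w j i) (S : Finset (Fin n)) (x : Fin n → ℝ) :
    HasFDerivAt (FS p w S) (LinearMap.toContinuousLinearMap (Matrix.toLin' (HS p w S x))) x := by
  have h := HasFDerivAt.fun_sum (u := S) fun j _ => pm_hasFDerivAt p (hw j) (hw' j) x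
  refine HasFDerivAt.congr_fderiv h ?_
  rw [HS, Hmat, map_sum, map_sum]

lemma HS_quad (p : ι → Fin n → ℝ) (w : Fin n → ι → ℝ) (S : Finset (Fin n))
    (x v : Fin n → ℝ) : v ⬝ᵥ (HS p w S x).mulVec v
      = ∑ j ∈ S, ∑ i, pq p (w j) x i * ((p i - pm p (w j) x) ⬝ᵥ v) ^ 2 := by
  rw [HS, Hmat, Matrix.sum_mulVec, dotProduct_sum]
  refine Finset.sum_congr rfl fun j _ => ?_
  rw [Matrix.sum_mulVec, dotProduct_sum]
  refine Finset.sum_congr rfl fun i _ => ?_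
  rw [Matrix.smul_mulVec, dotProduct_smul, Matrix.vecMulVec_mulVec]
  simp [dotProduct_comm v]
  left; ring

/-- degenerate direction -/
lemma HS_degenerate (p : ι → Fin n → ℝ) {w : Fin n → ι → ℝ} (hw : ∀ j i, 0 ≤ w j i)
    (hw' : ∀ j, ∃ i, 0 < w j i) (S : Finset (Fin n)) (x v : Fin n → ℝ)
    (h : v ⬝ᵥ (HS p w S x).mulVec v = 0) (y : Fin n → ℝ) : (HS p w S y).mulVec v = 0 := by
  rw [HS_quad, Finset.sum_eq_zero_iff_of_nonneg (fun j _ => Finset.sum_nonneg fun i _ =>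
    mul_nonneg (pq_nonneg p (hw j) x i) (sq_nonneg _))] at h
  have h1 : ∀ j ∈ S, ∀ i, 0 < w j i → p i ⬝ᵥ v = pm p (w j) x ⬝ᵥ v := by
    intro j hj i hi
    have h2 := h j hj
    rw [Finset.sum_eq_zero_iff_of_nonneg (fun i _ =>
      mul_nonneg (pq_nonneg p (hw j) x i) (sq_nonneg _))] at h2
    have h3 := h2 i (Finset.mem_univ _)
    have h4 : 0 < pq p (w j) x i :=
      div_pos (mul_pos hi (Real.exp_pos _)) (pz_pos p (hw j) (hw' j) x)
    have h5 := (mul_eq_zero.1 h3).resolve_left h4.ne'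
    rw [sq_eq_zero_iff, sub_dotProduct] at h5
    linarith
  rw [HS, Hmat, Matrix.sum_mulVec]
  refine Finset.sum_eq_zero fun j hj => ?_
  rw [Matrix.sum_mulVec]
  refine Finset.sum_eq_zero fun i _ => ?_
  rw [Matrix.smul_mulVec, Matrix.vecMulVec_mulVec]
  rcases (hw j i).eq_or_lt with h0 | h0
  · simp [pq, ← h0]
  · have : (p i - pm p (w j) y) ⬝ᵥ v = 0 := by
      rw [sub_dotProduct, h1 j hj i h0]
      rw [pm_dot p (w j) y]
      have : ∀ i, pq p (w j) y i * (p i ⬝ᵥ v) = pq p (w j) y i * (pm p (w j) x ⬝ᵥ v) := by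
        intro i
        rcases (hw j i).eq_or_lt with h0 | h0
        · simp [pq, ← h0]
        · rw [h1 j hj i h0]
      simp_rw [this]
      rw [← Finset.sum_mul, pq_sum p (hw j) (hw' j), one_mul, sub_self]
    simp [this]

end softmax


section softmax
variable {n : ℕ} {ι : Type*} [Fintype ι]

/-- Polytope spanned by the points of positive weight. -/
def PT (p : ι → Fin n → ℝ) (w : ι → ℝ) : Set (Fin n → ℝ) := convexHull ℝ (p '' {i | 0 < w i})

lemma PT_convex_sum (p : ι → Fin n → ℝ) (w : Fin n → ι → ℝ) (S : Finset (Fin n)) :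
    Convex ℝ (∑ j ∈ S, PT p (w j)) := convex_sum _ fun _ _ => convex_convexHull ℝ _

lemma isCompact_finsum {κ : Type*} (S : Finset κ) (K : κ → Set (Fin n → ℝ))
    (h : ∀ j ∈ S, IsCompact (K j)) : IsCompact (∑ j ∈ S, K j) := by
  classical
  induction S using Finset.induction_on with
  | empty => rw [Finset.sum_empty, ← Set.singleton_zero]; exact isCompact_singleton
  | insert a S ha ih =>
    rw [Finset.sum_insert ha]
    exact (h a (Finset.mem_insert_self _ _)).add
      (ih fun j hj => h j (Finset.mem_insert_of_mem hj))

lemma PT_compact_sum (p : ι → Fin n → ℝ) (w : Fin n → ι → ℝ) (S : Finset (Fin n)) :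
    IsCompact (∑ j ∈ S, PT p (w j)) :=
  isCompact_finsum _ _ fun _ _ => ((Set.toFinite _).image p).isCompact_convexHull ℝ

lemma pm_mem (p : ι → Fin n → ℝ) {w : ι → ℝ} (hw : ∀ i, 0 ≤ w i) (hw' : ∃ i, 0 < w i)
    (x : Fin n → ℝ) : pm p w x ∈ PT p w := by
  classical
  have h1 : pm p w x = ∑ i ∈ Finset.univ.filter (fun i => 0 < w i), pq p w x i • p i := by
    rw [pm, Finset.sum_filter_of_ne]
    intro i _ hi
    by_contra h
    have : w i = 0 := le_antisymm (not_lt.1 h) (hw i)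
    exact hi (by simp [pq, this])
  have h2 : ∑ i ∈ Finset.univ.filter (fun i => 0 < w i), pq p w x i = 1 := by
    rw [← pq_sum p hw hw' x, Finset.sum_filter_of_ne]
    intro i _ hi
    by_contra h
    have : w i = 0 := le_antisymm (not_lt.1 h) (hw i)
    exact hi (by simp [pq, this])
  rw [h1]
  refine (convex_convexHull ℝ _).sum_mem (fun i _ => pq_nonneg p hw x i) h2 fun i hi => ?_
  exact subset_convexHull ℝ _ ⟨i, (Finset.mem_filter.1 hi).2, rfl⟩

lemma FS_mem (p : ι → Fin n → ℝ) {w : Fin n → ι → ℝ} (hw : ∀ j i, 0 ≤ w j i)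
    (hw' : ∀ j, ∃ i, 0 < w j i) (S : Finset (Fin n)) (x : Fin n → ℝ) :
    FS p w S x ∈ ∑ j ∈ S, PT p (w j) :=
  Set.finsetSum_mem_finsetSum _ _ _ fun j _ => pm_mem p (hw j) (hw' j) x

lemma logpz_ge (p : ι → Fin n → ℝ) {w : ι → ℝ} (hw : ∀ i, 0 ≤ w i) (hw' : ∃ i, 0 < w i) :
    ∃ C : ℝ, ∀ x, ∀ z ∈ PT p w, z ⬝ᵥ x + C ≤ Real.log (pz p w x) := by
  obtain ⟨C, hC⟩ := (Set.finite_range (fun i => Real.log (w i))).bddBelow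
  refine ⟨C, fun x z hz => ?_⟩
  have hconv : Convex ℝ {z : Fin n → ℝ | dotL x z ≤ Real.log (pz p w x) - C} :=
    convex_halfSpace_le (dotL x).toLinearMap.isLinear _
  have : PT p w ⊆ {z : Fin n → ℝ | dotL x z ≤ Real.log (pz p w x) - C} := by
    refine convexHull_min ?_ hconv
    rintro _ ⟨i, hi, rfl⟩
    have hi : 0 < w i := hi
    have h1 : w i * Real.exp (p i ⬝ᵥ x) ≤ pz p w x :=
      Finset.single_le_sum (f := fun i => w i * Real.exp (p i ⬝ᵥ x))
        (fun i _ => mul_nonneg (hw i) (Real.exp_pos _).le) (Finset.mem_univ i)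
    have h2 := Real.log_le_log (mul_pos hi (Real.exp_pos _)) h1
    rw [Real.log_mul hi.ne' (Real.exp_pos _).ne', Real.log_exp] at h2
    have h3 : C ≤ Real.log (w i) := hC ⟨i, rfl⟩
    simp only [Set.mem_ofPred_eq, dotL_apply, dotProduct_comm x]
    linarith
  have := this hz
  simp only [Set.mem_ofPred_eq, dotL_apply, dotProduct_comm x] at this
  linarith

lemma FS_surj (p : ι → Fin n → ℝ) {w : Fin n → ι → ℝ} (hw : ∀ j i, 0 ≤ w j i)
    (hw' : ∀ j, ∃ i, 0 < w j i) (S : Finset (Fin n)) (y : Fin n → ℝ)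
    (hy : y ∈ interior (∑ j ∈ S, PT p (w j))) : ∃ x, FS p w S x = y := by
  classical
  choose C hC using fun j => logpz_ge p (hw j) (hw' j)
  have hge : ∀ x, ∀ z ∈ ∑ j ∈ S, PT p (w j),
      z ⬝ᵥ x + ∑ j ∈ S, C j ≤ ∑ j ∈ S, Real.log (pz p (w j) x) := by
    intro x z hz
    obtain ⟨g, hg, rfl⟩ := (Set.mem_finsetSum _ _ _).1 hz
    rw [sum_dotProduct, ← Finset.sum_add_distrib]
    exact Finset.sum_le_sum fun j hj => hC j x _ (hg hj)
  obtain ⟨r, hr, hball⟩ := Metric.nhds_basis_closedBall.mem_iff.1 (mem_interior_iff_mem_nhds.1 hy)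
  set Φ : (Fin n → ℝ) → ℝ := fun x => ∑ j ∈ S, Real.log (pz p (w j) x) - dotL y x with hΦ
  have hD : ∀ x, HasFDerivAt Φ (dotL (FS p w S x) - dotL y) x := by
    intro x
    have h := (HasFDerivAt.fun_sum (u := S) fun j _ => logpz_hasFDerivAt p (hw j) (hw' j) x).fun_sub
      ((dotL y).hasFDerivAt (x := x))
    refine h.congr_fderiv ?_
    congr 1
    ext d
    simp [FS, sum_dotProduct]
  have hlow : ∀ x, r * ‖x‖ + ∑ j ∈ S, C j ≤ Φ x := by
    intro x
    set s : Fin n → ℝ := fun k => if 0 ≤ x k then 1 else -1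
    have hs : ∀ k, s k * x k = |x k| := by
      intro k
      by_cases h : 0 ≤ x k
      · simp [s, h, abs_of_nonneg]
      · simp [s, h, abs_of_neg (not_le.1 h)]
    have hmem : y + r • s ∈ ∑ j ∈ S, PT p (w j) := by
      apply hball
      rw [Metric.mem_closedBall, dist_eq_norm, add_sub_cancel_left,
        pi_norm_le_iff_of_nonneg hr.le]
      intro k
      simp only [Pi.smul_apply, smul_eq_mul, norm_mul, Real.norm_eq_abs, abs_of_pos hr]
      have : |s k| = 1 := by
        simp only [s]; split_ifs <;> simp
      rw [this, mul_one]
    have h1 := hge x _ hmem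
    have h2 : ‖x‖ ≤ s ⬝ᵥ x := by
      have h0 : 0 ≤ s ⬝ᵥ x := Finset.sum_nonneg fun k _ => by rw [hs]; exact abs_nonneg _
      rw [pi_norm_le_iff_of_nonneg h0]
      intro k
      have : |x k| ≤ ∑ k, |x k| := Finset.single_le_sum (f := fun k => |x k|)
        (fun k _ => abs_nonneg _) (Finset.mem_univ k)
      simpa [dotProduct, hs] using this
    rw [add_dotProduct, smul_dotProduct, smul_eq_mul] at h1
    have h3 := mul_le_mul_of_nonneg_left h2 hr.le
    simp only [hΦ, dotL_apply]
    linarith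
  have hcont : Continuous Φ := continuous_iff_continuousAt.2 fun x => (hD x).continuousAt
  have htend : Filter.Tendsto Φ (Filter.cocompact _) Filter.atTop := by
    refine Filter.tendsto_atTop_mono hlow ?_
    refine Filter.tendsto_atTop_add_const_right _ _ ?_
    exact (tendsto_norm_cocompact_atTop).const_mul_atTop hr
  obtain ⟨x, hx⟩ := hcont.exists_forall_le htend
  refine ⟨x, ?_⟩
  have h0 : dotL (FS p w S x) - dotL y = 0 :=
    IsLocalMin.hasFDerivAt_eq_zero (Filter.Eventually.of_forall hx) (hD x)
  ext k
  have := congrArg (fun L => L (Pi.single k 1)) h0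
  simp at this
  linarith

lemma FS_inj (p : ι → Fin n → ℝ) {w : Fin n → ι → ℝ} (hw : ∀ j i, 0 ≤ w j i)
    (hw' : ∀ j, ∃ i, 0 < w j i) (S : Finset (Fin n))
    (hpos : ∀ x v, v ≠ 0 → v ⬝ᵥ (HS p w S x).mulVec v ≠ 0) : Function.Injective (FS p w S) := by
  intro x y hxy
  by_contra hne
  set d := y - x with hd
  have hd0 : d ≠ 0 := sub_ne_zero.2 (Ne.symm hne)
  have hder : ∀ t : ℝ, HasDerivAt (fun t : ℝ => dotL d (FS p w S (x + t • d)))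
      (d ⬝ᵥ (HS p w S (x + t • d)).mulVec d) t := by
    intro t
    have h1 : HasDerivAt (fun t : ℝ => x + t • d) d t := by
      simpa using ((hasDerivAt_id t).smul_const d).const_add x
    have h2 := (FS_hasFDerivAt p hw hw' S (x + t • d)).comp_hasDerivAt t h1
    have h3 := (dotL d).hasFDerivAt.comp_hasDerivAt t h2
    simpa [Function.comp_def] using h3
  have hmono : StrictMono (fun t : ℝ => dotL d (FS p w S (x + t • d))) := by
    refine strictMono_of_hasDerivAt_pos hder fun t => lt_of_le_of_ne ?_ (hpos _ _ hd0).symm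
    rw [HS_quad]
    exact Finset.sum_nonneg fun j _ => Finset.sum_nonneg fun i _ =>
      mul_nonneg (pq_nonneg p (hw j) _ i) (sq_nonneg _)
  have h01 := hmono (zero_lt_one)
  simp [hd, hxy] at h01

lemma convex_volume_interior {A : Set (Fin n → ℝ)} (h : Convex ℝ A) :
    volume (interior A) = volume A := by
  refine le_antisymm (measure_mono interior_subset) ?_
  calc volume A ≤ volume (interior A ∪ frontier A) := by
        refine measure_mono (subset_closure.trans ?_)
        rw [closure_eq_interior_union_frontier]
    _ ≤ volume (interior A) + volume (frontier A) := measure_union_le _ _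
    _ = _ := by rw [h.addHaar_frontier volume, add_zero]

lemma convex_volume_closure {A : Set (Fin n → ℝ)} (h : Convex ℝ A) :
    volume (closure A) = volume A := by
  refine le_antisymm ?_ (measure_mono subset_closure)
  calc volume (closure A) = volume (interior A ∪ frontier A) := by
        rw [closure_eq_interior_union_frontier]
    _ ≤ volume (interior A) + volume (frontier A) := measure_union_le _ _
    _ ≤ _ := by rw [h.addHaar_frontier volume, add_zero]; exact measure_mono interior_subset

lemma volume_PT_sum (p : ι → Fin n → ℝ) {w : Fin n → ι → ℝ} (hw : ∀ j i, 0 ≤ w j i)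
    (hw' : ∀ j, ∃ i, 0 < w j i) (S : Finset (Fin n)) :
    volume (∑ j ∈ S, PT p (w j)) = ∫⁻ x, ENNReal.ofReal (HS p w S x).det := by
  have hdet : ∀ x, |(LinearMap.toContinuousLinearMap (Matrix.toLin' (HS p w S x))).det|
      = (HS p w S x).det := by
    intro x
    have : (LinearMap.toContinuousLinearMap (Matrix.toLin' (HS p w S x))).det
      = (HS p w S x).det := by
      simp [ContinuousLinearMap.det]
    rw [this, abs_of_nonneg]
    exact det_Hmat_nonneg _ _ _ fun j i => pq_nonneg p (hw j) x i
  have hle : volume (∑ j ∈ S, PT p (w j)) ≤ ∫⁻ x, ENNReal.ofReal (HS p w S x).det := by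
    rw [← convex_volume_interior (PT_convex_sum p w S)]
    have h1 : interior (∑ j ∈ S, PT p (w j)) ⊆ FS p w S '' Set.univ := by
      intro y hy
      obtain ⟨x, hx⟩ := FS_surj p hw hw' S y hy
      exact ⟨x, trivial, hx⟩
    refine (measure_mono h1).trans ?_
    have h2 := addHaar_image_le_lintegral_abs_det_fderiv volume MeasurableSet.univ
      (fun x _ => (FS_hasFDerivAt p hw hw' S x).hasFDerivWithinAt (s := Set.univ))
    simpa only [hdet, Measure.restrict_univ] using h2
  refine le_antisymm hle ?_
  by_cases hpos : ∀ x v, v ≠ 0 → v ⬝ᵥ (HS p w S x).mulVec v ≠ 0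
  · have h2 := lintegral_abs_det_fderiv_eq_addHaar_image volume MeasurableSet.univ
      (fun x _ => (FS_hasFDerivAt p hw hw' S x).hasFDerivWithinAt (s := Set.univ))
      (FS_inj p hw hw' S hpos).injOn
    simp only [hdet, Measure.restrict_univ] at h2
    rw [h2]
    refine measure_mono ?_
    rintro _ ⟨x, _, rfl⟩
    exact FS_mem p hw hw' S x
  · push Not at hpos
    obtain ⟨x, v, hv, h0⟩ := hpos
    have : ∀ y, (HS p w S y).det = 0 := fun y =>
      Matrix.exists_mulVec_eq_zero_iff.1 ⟨v, hv, HS_degenerate p hw hw' S x v h0 y⟩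
    simp [this]

end softmax


section softmax
variable {n : ℕ} {ι : Type*} [Fintype ι]

noncomputable def DD (p : ι → Fin n → ℝ) (w : Fin n → ι → ℝ) (x : Fin n → ℝ) : ℝ :=
  mdisc (fun j => pq p (w j) x) (fun j i => p i - pm p (w j) x)

lemma DD_nonneg (p : ι → Fin n → ℝ) {w : Fin n → ι → ℝ} (hw : ∀ j i, 0 ≤ w j i)
    (x : Fin n → ℝ) : 0 ≤ DD p w x :=
  mdisc_nonneg _ _ fun j i => pq_nonneg p (hw j) x i

lemma HS_continuous (p : ι → Fin n → ℝ) {w : Fin n → ι → ℝ} (hw : ∀ j i, 0 ≤ w j i)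
    (hw' : ∀ j, ∃ i, 0 < w j i) (S : Finset (Fin n)) :
    Continuous (HS p w S) := by
  have h1 : ∀ j i, Continuous fun x => pq p (w j) x i := fun j i =>
    continuous_iff_continuousAt.2 fun x => (pq_hasFDerivAt p (hw j) (hw' j) x i).continuousAt
  have h2 : ∀ j, Continuous fun x => pm p (w j) x := fun j =>
    continuous_iff_continuousAt.2 fun x => (pm_hasFDerivAt p (hw j) (hw' j) x).continuousAt
  unfold HS Hmat
  refine continuous_finsetSum _ fun j _ => continuous_finsetSum _ fun i _ => ?_
  exact (h1 j i).smul (Continuous.matrix_vecMulVec (continuous_const.sub (h2 j))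
    (continuous_const.sub (h2 j)))

lemma MV_PT (hn : 1 ≤ n) (p : ι → Fin n → ℝ) {w : Fin n → ι → ℝ} (hw : ∀ j i, 0 ≤ w j i)
    (hw' : ∀ j, ∃ i, 0 < w j i) :
    0 ≤ MV n (fun j => PT p (w j)) ∧
    ENNReal.ofReal (MV n (fun j => PT p (w j))) = ∫⁻ x, ENNReal.ofReal (DD p w x) := by
  have hnn : ∀ S x, 0 ≤ (HS p w S x).det := fun S x =>
    det_Hmat_nonneg _ _ _ fun j i => pq_nonneg p (hw j) x i
  have hint : ∀ S, Integrable (fun x => (HS p w S x).det) := by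
    intro S
    refine ⟨((HS_continuous p hw hw' S).matrix_det).aestronglyMeasurable, ?_⟩
    rw [hasFiniteIntegral_iff_ofReal (Filter.Eventually.of_forall (hnn S)),
      ← volume_PT_sum p hw hw' S]
    exact (PT_compact_sum p w S).measure_lt_top
  have hvol : ∀ S, vol (∑ j ∈ S, PT p (w j)) = ∫ x, (HS p w S x).det := by
    intro S
    rw [vol, volume_PT_sum p hw hw' S, integral_eq_lintegral_of_nonneg_ae
      (Filter.Eventually.of_forall (hnn S))
      ((HS_continuous p hw hw' S).matrix_det).aestronglyMeasurable]
  have hDD : ∀ x, DD p w x = ∑ S : Finset (Fin n), (-1 : ℝ) ^ (n - #S) * (HS p w S x).det :=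
    fun x => (mdisc_eq _ _).symm
  have hMV : MV n (fun j => PT p (w j)) = ∫ x, DD p w x := by
    rw [MV_eq hn]
    simp_rw [hDD, hvol]
    rw [integral_finsetSum _ fun S _ => (hint S).const_mul _]
    simp_rw [integral_const_mul]
  have hDint : Integrable (DD p w) := by
    have := integrable_finsetSum Finset.univ
      fun (S : Finset (Fin n)) _ => (hint S).const_mul ((-1 : ℝ) ^ (n - #S))
    refine this.congr (Filter.Eventually.of_forall fun x => ?_)
    simp [hDD]
  rw [hMV]
  refine ⟨integral_nonneg fun x => DD_nonneg p hw x, ?_⟩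
  exact ofReal_integral_eq_lintegral_ofReal hDint
    (Filter.Eventually.of_forall fun x => DD_nonneg p hw x)

lemma DD_measurable (p : ι → Fin n → ℝ) {w : Fin n → ι → ℝ} (hw : ∀ j i, 0 ≤ w j i)
    (hw' : ∀ j, ∃ i, 0 < w j i) : Measurable (DD p w) := by
  have hDD : DD p w = fun x =>
      ∑ S : Finset (Fin n), (-1 : ℝ) ^ (n - #S) * (HS p w S x).det :=
    funext fun x => (mdisc_eq _ _).symm
  rw [hDD]
  refine Finset.measurable_fun_sum _ fun S _ => ?_
  exact ((HS_continuous p hw hw' S).matrix_det).measurable.const_mul _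

lemma pq_shift (p : ι → Fin n → ℝ) (w w' : ι → ℝ) (x y : Fin n → ℝ) (a : ℝ) (ha : a ≠ 0)
    (h : ∀ i, w' i = a * w i * Real.exp (p i ⬝ᵥ y)) : pq p w (x + y) = pq p w' x := by
  have h1 : ∀ i, w' i * Real.exp (p i ⬝ᵥ x) = a * (w i * Real.exp (p i ⬝ᵥ (x + y))) := by
    intro i
    rw [h, dotProduct_add, Real.exp_add]; ring
  ext i
  simp only [pq, pz, h1]
  rw [← Finset.mul_sum, mul_div_mul_left _ _ ha]

lemma DD_shift (p : ι → Fin n → ℝ) (w w' : Fin n → ι → ℝ) (x y : Fin n → ℝ) (a : Fin n → ℝ)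
    (ha : ∀ j, a j ≠ 0)
    (h : ∀ j i, w' j i = a j * w j i * Real.exp (p i ⬝ᵥ y)) : DD p w (x + y) = DD p w' x := by
  have := fun j => pq_shift p (w j) (w' j) x y (a j) (ha j) (h j)
  simp only [DD, pm, this]

lemma mdisc_continuous : Continuous fun qu : (Fin n → ι → ℝ) × (Fin n → ι → Fin n → ℝ) =>
    mdisc qu.1 qu.2 := by
  unfold mdisc
  refine continuous_const.mul (continuous_finsetSum _ fun f _ => ?_)
  split_ifs
  · refine Continuous.mul (by fun_prop) (Continuous.pow (Continuous.matrix_det ?_) 2)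
    refine continuous_matrix fun k l => ?_
    simp only [Matrix.of_apply]
    fun_prop
  · exact continuous_const

lemma DD_tendsto (p : ι → Fin n → ℝ) (v : ℕ → Fin n → ι → ℝ) {w : Fin n → ι → ℝ}
    (hw : ∀ j i, 0 ≤ w j i)
    (hw' : ∀ j, ∃ i, 0 < w j i) (hv : ∀ j i, Filter.Tendsto (fun N => v N j i) Filter.atTop
      (nhds (w j i))) (x : Fin n → ℝ) :
    Filter.Tendsto (fun N => DD p (v N) x) Filter.atTop (nhds (DD p w x)) := by
  have hq : ∀ j i, Filter.Tendsto (fun N => pq p (v N j) x i) Filter.atTop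
      (nhds (pq p (w j) x i)) := by
    intro j i
    refine Filter.Tendsto.div ((hv j i).mul_const _) ?_ (pz_pos p (hw j) (hw' j) x).ne'
    exact tendsto_finsetSum _ fun i _ => (hv j i).mul_const _
  have hm : ∀ j, Filter.Tendsto (fun N => pm p (v N j) x) Filter.atTop
      (nhds (pm p (w j) x)) := by
    intro j
    unfold pm
    exact tendsto_finsetSum _ fun i _ => (hq j i).smul_const _
  have h1 : Filter.Tendsto (fun N => (fun j => pq p (v N j) x)) Filter.atTop
      (nhds (fun j => pq p (w j) x)) :=
    tendsto_pi_nhds.2 fun j => tendsto_pi_nhds.2 fun i => hq j i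
  have h2 : Filter.Tendsto (fun N => (fun j i => p i - pm p (v N j) x)) Filter.atTop
      (nhds (fun j i => p i - pm p (w j) x)) :=
    tendsto_pi_nhds.2 fun j => tendsto_pi_nhds.2 fun i => tendsto_const_nhds.sub (hm j)
  have h3 := h1.prodMk_nhds h2
  have h4 := (mdisc_continuous (n := n) (ι := ι)).tendsto ((fun j => pq p (w j) x),
    (fun j i => p i - pm p (w j) x))
  have h5 := h4.comp h3
  unfold DD
  exact h5

lemma superadd_fin (hn : 1 ≤ n) (p : ι → Fin n → ℝ) (K A B : Fin n → Set ι)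
    (hAK : ∀ j, A j ⊆ K j) (hBK : ∀ j, B j ⊆ K j)
    (hA : ∀ j, (A j).Nonempty) (hB : ∀ j, (B j).Nonempty) (k : Fin n) (c : Fin n → ℝ)
    (hAc : ∀ j, ∀ i ∈ A j, p i k < c j) (hBc : ∀ j, ∀ i ∈ B j, c j < p i k) :
    MV n (fun j => convexHull ℝ (p '' A j)) + MV n (fun j => convexHull ℝ (p '' B j))
      ≤ MV n (fun j => convexHull ℝ (p '' K j)) := by
  classical
  have hM : ∀ j, ∃ M, ∀ i, |p i k - c j| < M := by
    intro j
    obtain ⟨M, hM⟩ := (Set.finite_range (fun i => |p i k - c j|)).bddAbove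
    exact ⟨M + 1, fun i => by have := hM ⟨i, rfl⟩; simp only at this; linarith⟩
  choose M hM using hM
  set f : Fin n → ι → ℝ := fun j i => if i ∈ A j ∪ B j then |p i k - c j| else M j with hf
  set wA : Fin n → ι → ℝ := fun j i => if i ∈ A j then 1 else 0 with hwA
  set wB : Fin n → ι → ℝ := fun j i => if i ∈ B j then 1 else 0 with hwB
  set w : ℕ → Fin n → ι → ℝ := fun N j i => if i ∈ K j then Real.exp (-(N * f j i)) else 0 with hw
  set vA : ℕ → Fin n → ι → ℝ := fun N j i =>
    if i ∈ K j then Real.exp (-(N * (f j i + (p i k - c j)))) else 0 with hvA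
  set vB : ℕ → Fin n → ι → ℝ := fun N j i =>
    if i ∈ K j then Real.exp (-(N * (f j i - (p i k - c j)))) else 0 with hvB
  have PA : ∀ j, PT p (wA j) = convexHull ℝ (p '' A j) := by
    intro j; simp only [PT, hwA]; congr 2; ext i; by_cases h : i ∈ A j <;> simp [h]
  have PB : ∀ j, PT p (wB j) = convexHull ℝ (p '' B j) := by
    intro j; simp only [PT, hwB]; congr 2; ext i; by_cases h : i ∈ B j <;> simp [h]
  have PK : ∀ N j, PT p (w N j) = convexHull ℝ (p '' K j) := by
    intro N j; simp only [PT, hw]; congr 2; ext i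
    by_cases h : i ∈ K j <;> simp [h, Real.exp_pos]
  have wA0 : ∀ j i, 0 ≤ wA j i := fun j i => by simp only [hwA]; split_ifs <;> simp
  have wB0 : ∀ j i, 0 ≤ wB j i := fun j i => by simp only [hwB]; split_ifs <;> simp
  have w0 : ∀ N j i, 0 ≤ w N j i := fun N j i => by simp only [hw]; split_ifs <;> positivity
  have wA1 : ∀ j, ∃ i, 0 < wA j i := fun j => by
    obtain ⟨i, hi⟩ := hA j; exact ⟨i, by simp [hwA, hi]⟩
  have wB1 : ∀ j, ∃ i, 0 < wB j i := fun j => by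
    obtain ⟨i, hi⟩ := hB j; exact ⟨i, by simp [hwB, hi]⟩
  have w1 : ∀ N j, ∃ i, 0 < w N j i := fun N j => by
    obtain ⟨i, hi⟩ := hA j; exact ⟨i, by simp [hw, hAK j hi, Real.exp_pos]⟩
  have IA := MV_PT hn p wA0 wA1
  have IB := MV_PT hn p wB0 wB1
  have IK := fun N => MV_PT hn p (w0 N) (w1 N)
  simp only [PA] at IA
  simp only [PB] at IB
  simp only [PK] at IK
  have expt : ∀ e : ℝ, 0 < e → Filter.Tendsto (fun N : ℕ => Real.exp (-(N * e))) Filter.atTop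
      (nhds 0) := by
    intro e he
    refine Real.tendsto_exp_neg_atTop_nhds_zero.comp ?_
    exact tendsto_natCast_atTop_atTop.atTop_mul_const he
  have tA : ∀ j i, Filter.Tendsto (fun N => vA N j i) Filter.atTop (nhds (wA j i)) := by
    intro j i
    simp only [hvA, hwA]
    by_cases hK : i ∈ K j
    · simp only [hK, if_true]
      by_cases h : i ∈ A j
      · have h1 := hAc j i h
        have : f j i + (p i k - c j) = 0 := by
          simp only [hf, Set.mem_union, h, true_or, if_true]
          rw [abs_of_neg (by linarith)]; ring
        simp [h, this]
      · simp only [h, if_false]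
        apply expt
        by_cases h' : i ∈ B j
        · have h1 := hBc j i h'
          simp only [hf, Set.mem_union, h', or_true, if_true]
          rw [abs_of_pos (by linarith)]; linarith
        · have h1 := hM j i
          simp only [hf, Set.mem_union, h, h', or_false, if_false]
          have := neg_abs_le (p i k - c j)
          linarith
    · have h : i ∉ A j := fun h => hK (hAK j h)
      simp [hK, h]
  have tB : ∀ j i, Filter.Tendsto (fun N => vB N j i) Filter.atTop (nhds (wB j i)) := by
    intro j i
    simp only [hvB, hwB]
    by_cases hK : i ∈ K j
    · simp only [hK, if_true]
      by_cases h : i ∈ B j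
      · have h1 := hBc j i h
        have : f j i - (p i k - c j) = 0 := by
          simp only [hf, Set.mem_union, h, or_true, if_true]
          rw [abs_of_pos (by linarith)]; ring
        simp [h, this]
      · simp only [h, if_false]
        apply expt
        by_cases h' : i ∈ A j
        · have h1 := hAc j i h'
          simp only [hf, Set.mem_union, h', true_or, if_true]
          rw [abs_of_neg (by linarith)]; linarith
        · have h1 := hM j i
          simp only [hf, Set.mem_union, h, h', or_false, if_false]
          have := le_abs_self (p i k - c j)
          linarith
    · have h : i ∉ B j := fun h => hK (hBK j h)
      simp [hK, h]
  have sA : ∀ (N : ℕ) x, DD p (w N) (x + Pi.single k (-(N : ℝ))) = DD p (vA N) x := by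
    intro N x
    refine DD_shift p _ _ x _ (fun j => Real.exp (N * c j)) (fun j => (Real.exp_pos _).ne') ?_
    intro j i
    simp only [hw, hvA]
    split_ifs
    · rw [← Real.exp_add, ← Real.exp_add, dotProduct_single]; congr 1; ring
    · simp
  have sB : ∀ (N : ℕ) x, DD p (w N) (x + Pi.single k (N : ℝ)) = DD p (vB N) x := by
    intro N x
    refine DD_shift p _ _ x _ (fun j => Real.exp (-(N * c j))) (fun j => (Real.exp_pos _).ne') ?_
    intro j i
    simp only [hw, hvB]
    split_ifs
    · rw [← Real.exp_add, ← Real.exp_add, dotProduct_single]; congr 1; ring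
    · simp
  -- the two halves
  set U : Set (Fin n → ℝ) := {x | x k < 0} with hU
  set V : Set (Fin n → ℝ) := {x | 0 < x k} with hV
  have mU : MeasurableSet U := measurableSet_lt (measurable_pi_apply k) measurable_const
  have mV : MeasurableSet V := measurableSet_lt measurable_const (measurable_pi_apply k)
  set g : ℕ → (Fin n → ℝ) → ENNReal := fun N x => ENNReal.ofReal (DD p (w N) x) with hg
  have mg : ∀ N, Measurable (g N) := fun N =>
    (DD_measurable p (w0 N) (w1 N)).ennreal_ofReal
  set G : ℕ → (Fin n → ℝ) → ENNReal := fun N x =>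
    U.indicator (g N) (x + Pi.single k (-(N : ℝ))) + V.indicator (g N) (x + Pi.single k (N : ℝ))
    with hG
  have mG : ∀ N, Measurable (G N) := fun N =>
    (((mg N).indicator mU).comp (measurable_id.add_const _)).add
      (((mg N).indicator mV).comp (measurable_id.add_const _))
  have hGint : ∀ N, ∫⁻ x, G N x ≤ ENNReal.ofReal (MV n (fun j => convexHull ℝ (p '' K j))) := by
    intro N
    rw [(IK N).2]
    simp only [hG]
    have h0 : Measurable fun x : Fin n → ℝ => U.indicator (g N) (x + Pi.single k (-(N : ℝ))) :=
      ((mg N).indicator mU).comp (measurable_id.add_const _)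
    rw [lintegral_add_left h0,
      lintegral_add_right_eq_self (μ := volume) (U.indicator (g N)),
      lintegral_add_right_eq_self (μ := volume) (V.indicator (g N)),
      ← lintegral_add_left ((mg N).indicator mU)]
    refine lintegral_mono fun x => ?_
    by_cases h : x k < 0
    · have h2 : x ∉ V := fun h' => lt_asymm h h'
      have h1 : x ∈ U := h
      simp [h1, h2, hg]
    · have h2 : x ∉ U := h
      simp only [h2, not_false_eq_true, Set.indicator_of_notMem, zero_add]
      exact Set.indicator_le_self _ _ _
  have hlim : ∀ x, Filter.Tendsto (fun N => G N x) Filter.atTop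
      (nhds (ENNReal.ofReal (DD p wA x) + ENNReal.ofReal (DD p wB x))) := by
    intro x
    refine Filter.Tendsto.add ?_ ?_
    · refine (ENNReal.tendsto_ofReal (DD_tendsto p vA wA0 wA1 tA x)).congr' ?_
      filter_upwards [(tendsto_natCast_atTop_atTop (R := ℝ)).eventually_gt_atTop (x k)] with N hN
      have h1 : x + Pi.single k (-(N : ℝ)) ∈ U := by
        simp only [hU, Set.mem_ofPred_eq, Pi.add_apply, Pi.single_eq_same]; linarith
      rw [Set.indicator_of_mem h1, hg]
      simp only [sA]
    · refine (ENNReal.tendsto_ofReal (DD_tendsto p vB wB0 wB1 tB x)).congr' ?_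
      filter_upwards [(tendsto_natCast_atTop_atTop (R := ℝ)).eventually_gt_atTop (-x k)] with N hN
      have h1 : x + Pi.single k (N : ℝ) ∈ V := by
        simp only [hV, Set.mem_ofPred_eq, Pi.add_apply, Pi.single_eq_same]; linarith
      rw [Set.indicator_of_mem h1, hg]
      simp only [sB]
  have hfin : ENNReal.ofReal (MV n (fun j => convexHull ℝ (p '' A j)))
      + ENNReal.ofReal (MV n (fun j => convexHull ℝ (p '' B j)))
      ≤ ENNReal.ofReal (MV n (fun j => convexHull ℝ (p '' K j))) := by
    rw [IA.2, IB.2, ← lintegral_add_left (DD_measurable p wA0 wA1).ennreal_ofReal]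
    have : ∀ x, ENNReal.ofReal (DD p wA x) + ENNReal.ofReal (DD p wB x)
      = Filter.liminf (fun N => G N x) Filter.atTop := fun x => (hlim x).liminf_eq.symm
    simp_rw [this]
    refine (lintegral_liminf_le mG).trans ?_
    refine Filter.liminf_le_of_le (by isBoundedDefault) fun b hb => ?_
    obtain ⟨N, hN⟩ := hb.exists
    exact hN.trans (hGint N)
  rw [← ENNReal.ofReal_add IA.1 IB.1] at hfin
  exact (ENNReal.ofReal_le_ofReal_iff (IK 0).1).1 hfin

lemma MV_fin_nonneg (hn : 1 ≤ n) (p : ι → Fin n → ℝ) (K : Fin n → Set ι)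
    (hK : ∀ j, (K j).Nonempty) : 0 ≤ MV n (fun j => convexHull ℝ (p '' K j)) := by
  classical
  set wA : Fin n → ι → ℝ := fun j i => if i ∈ K j then 1 else 0 with hwA
  have PA : ∀ j, PT p (wA j) = convexHull ℝ (p '' K j) := by
    intro j; simp only [PT, hwA]; congr 2; ext i; by_cases h : i ∈ K j <;> simp [h]
  have wA0 : ∀ j i, 0 ≤ wA j i := fun j i => by simp only [hwA]; split_ifs <;> simp
  have wA1 : ∀ j, ∃ i, 0 < wA j i := fun j => by
    obtain ⟨i, hi⟩ := hK j; exact ⟨i, by simp [hwA, hi]⟩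
  have IA := MV_PT hn p wA0 wA1
  simp only [PA] at IA
  exact IA.1

end softmax


section approx
variable {n : ℕ}

/-- Convex hull of finitely many sample points. -/
def XT (d : ℕ → Fin n → ℝ) (X : Set (Fin n → ℝ)) (m : ℕ) : Set (Fin n → ℝ) :=
  convexHull ℝ ((fun i : Fin m => d i) '' {i | d i ∈ X})

lemma XT_mono (d : ℕ → Fin n → ℝ) (X : Set (Fin n → ℝ)) : Monotone (XT d X) := by
  intro a b hab
  refine convexHull_mono ?_
  rintro _ ⟨i, hi, rfl⟩
  exact ⟨Fin.castLE hab i, hi, rfl⟩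

lemma XT_sub (d : ℕ → Fin n → ℝ) {X : Set (Fin n → ℝ)} (hX : Convex ℝ X) (m : ℕ) :
    XT d X m ⊆ X := by
  refine convexHull_min ?_ hX
  rintro _ ⟨i, hi, rfl⟩
  exact hi

lemma bounded_finsum {κ : Type*} (S : Finset κ) (K : κ → Set (Fin n → ℝ))
    (h : ∀ j ∈ S, Bornology.IsBounded (K j)) : Bornology.IsBounded (∑ j ∈ S, K j) := by
  classical
  induction S using Finset.induction_on with
  | empty => rw [Finset.sum_empty, ← Set.singleton_zero]; exact Bornology.isBounded_singleton
  | insert a S ha ih =>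
    rw [Finset.sum_insert ha]
    exact (h a (Finset.mem_insert_self _ _)).add
      (ih fun j hj => h j (Finset.mem_insert_of_mem hj))

lemma vol_XT_tendsto (d : ℕ → Fin n → ℝ) (X : Fin n → Set (Fin n → ℝ))
    (hX : ∀ j, Convex ℝ (X j)) (hb : ∀ j, Bornology.IsBounded (X j))
    (hd : ∀ j, X j ⊆ closure (X j ∩ Set.range d)) (S : Finset (Fin n)) :
    Filter.Tendsto (fun m => vol (∑ j ∈ S, XT d (X j) m)) Filter.atTop
      (nhds (vol (∑ j ∈ S, X j))) := by
  have hmono : Monotone fun m => ∑ j ∈ S, XT d (X j) m := by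
    intro a b hab
    exact Set.finsetSum_subset_finsetSum _ _ _ fun j _ => XT_mono d (X j) hab
  have hfin : volume (∑ j ∈ S, X j) ≠ ⊤ :=
    (bounded_finsum S X fun j _ => hb j).measure_lt_top.ne
  have hsub : ⋃ m, ∑ j ∈ S, XT d (X j) m ⊆ ∑ j ∈ S, X j :=
    Set.iUnion_subset fun m =>
      Set.finsetSum_subset_finsetSum _ _ _ fun j _ => XT_sub d (hX j) m
  have hconv : Convex ℝ (⋃ m, ∑ j ∈ S, XT d (X j) m) :=
    hmono.directed_le.convex_iUnion fun m => convex_sum _ fun j _ => convex_convexHull ℝ _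
  have hcl : ∑ j ∈ S, X j ⊆ closure (⋃ m, ∑ j ∈ S, XT d (X j) m) := by
    intro x hx
    obtain ⟨g, hg, rfl⟩ := (Set.mem_finsetSum _ _ _).1 hx
    have h1 : g ∈ closure (Set.pi (S : Set (Fin n)) fun j => X j ∩ Set.range d) := by
      rw [closure_pi_set]
      exact fun j hj => hd j (hg hj)
    have hc : Continuous fun g : Fin n → Fin n → ℝ => ∑ j ∈ S, g j := by fun_prop
    have h2 := image_closure_subset_closure_image hc ⟨g, h1, rfl⟩
    refine closure_mono ?_ h2
    rintro _ ⟨f, hf, rfl⟩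
    have : ∀ j, ∃ i, j ∈ S → f j ∈ X j ∧ d i = f j := by
      intro j
      by_cases hj : j ∈ S
      · obtain ⟨h3, i, hi⟩ := hf j hj
        exact ⟨i, fun _ => ⟨h3, hi⟩⟩
      · exact ⟨0, fun h => absurd h hj⟩
    choose i hi using this
    refine Set.mem_iUnion.2 ⟨S.sup i + 1, ?_⟩
    refine Set.finsetSum_mem_finsetSum _ _ _ fun j hj => ?_
    refine subset_convexHull ℝ _ ?_
    have hlt : i j < S.sup i + 1 := Nat.lt_succ_of_le (Finset.le_sup hj)
    refine ⟨⟨i j, hlt⟩, ?_, (hi j hj).2⟩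
    change d (i j) ∈ X j
    rw [(hi j hj).2]
    exact (hi j hj).1
  have heq : volume (⋃ m, ∑ j ∈ S, XT d (X j) m) = volume (∑ j ∈ S, X j) := by
    refine le_antisymm (measure_mono hsub) ?_
    rw [← convex_volume_closure hconv]
    exact measure_mono hcl
  have ht := tendsto_measure_iUnion_atTop (μ := volume) hmono
  rw [heq] at ht
  exact (ENNReal.tendsto_toReal hfin).comp ht

lemma MV_XT_tendsto (hn : 1 ≤ n) (d : ℕ → Fin n → ℝ) (X : Fin n → Set (Fin n → ℝ))
    (hX : ∀ j, Convex ℝ (X j)) (hb : ∀ j, Bornology.IsBounded (X j))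
    (hd : ∀ j, X j ⊆ closure (X j ∩ Set.range d)) :
    Filter.Tendsto (fun m => MV n (fun j => XT d (X j) m)) Filter.atTop (nhds (MV n X)) := by
  simp_rw [MV_eq hn]
  exact tendsto_finsetSum _ fun S _ => (vol_XT_tendsto d X hX hb hd S).const_mul _

lemma exists_dense_seq {κ : Type*} [Countable κ] (X : κ → Set (Fin n → ℝ)) :
    ∃ d : ℕ → Fin n → ℝ, ∀ j, X j ⊆ closure (X j ∩ Set.range d) := by
  have h1 : ∀ j, ∃ t ⊆ X j, t.Countable ∧ X j ⊆ closure t := fun j =>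
    (TopologicalSpace.IsSeparable.of_separableSpace (X j)).exists_countable_dense_subset
  choose t ht htc hcl using h1
  have hc : (insert 0 (⋃ j, t j)).Countable := (Set.countable_iUnion htc).insert 0
  obtain ⟨d, hd⟩ := hc.exists_eq_range (Set.insert_nonempty _ _)
  refine ⟨d, fun j => (hcl j).trans (closure_mono ?_)⟩
  intro x hx
  refine ⟨ht j hx, ?_⟩
  rw [← hd]
  exact Set.mem_insert_of_mem _ (Set.mem_iUnion.2 ⟨j, hx⟩)

lemma eventually_nonempty (d : ℕ → Fin n → ℝ) (X : Fin n → Set (Fin n → ℝ))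
    (hne : ∀ j, (X j).Nonempty)
    (hd : ∀ j, X j ⊆ closure (X j ∩ Set.range d)) :
    ∀ᶠ m in Filter.atTop, ∀ j, ({i : Fin m | d i ∈ X j}).Nonempty := by
  rw [Filter.eventually_all]
  intro j
  obtain ⟨x, hx⟩ := hne j
  obtain ⟨y, hy, i, rfl⟩ := closure_nonempty_iff.1 ⟨x, hd j hx⟩
  filter_upwards [Filter.eventually_gt_atTop i] with m hm
  exact ⟨⟨i, hm⟩, hy⟩

lemma MV_nonneg (hn : 1 ≤ n) (K : Fin n → Set (Fin n → ℝ))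
    (hK : ∀ j, Convex ℝ (K j)) (hb : ∀ j, Bornology.IsBounded (K j))
    (hne : ∀ j, (K j).Nonempty) : 0 ≤ MV n K := by
  obtain ⟨d, hd⟩ := exists_dense_seq K
  refine ge_of_tendsto (MV_XT_tendsto hn d K hK hb hd) ?_
  filter_upwards [eventually_nonempty d K hne hd] with m hm
  exact MV_fin_nonneg hn _ _ hm

lemma superadd (hn : 1 ≤ n) (K A B : Fin n → Set (Fin n → ℝ))
    (hK : ∀ j, Convex ℝ (K j)) (hA : ∀ j, Convex ℝ (A j)) (hB : ∀ j, Convex ℝ (B j))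
    (hb : ∀ j, Bornology.IsBounded (K j)) (hAK : ∀ j, A j ⊆ K j) (hBK : ∀ j, B j ⊆ K j)
    (hAn : ∀ j, (A j).Nonempty) (hBn : ∀ j, (B j).Nonempty) (k : Fin n) (c : Fin n → ℝ)
    (hAc : ∀ j, ∀ x ∈ A j, x k < c j) (hBc : ∀ j, ∀ x ∈ B j, c j < x k) :
    MV n A + MV n B ≤ MV n K := by
  obtain ⟨d, hd⟩ := exists_dense_seq (Sum.elim K (Sum.elim A B))
  have hdK := fun j => hd (Sum.inl j)
  have hdA := fun j => hd (Sum.inr (Sum.inl j))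
  have hdB := fun j => hd (Sum.inr (Sum.inr j))
  simp only [Sum.elim_inl, Sum.elim_inr] at hdK hdA hdB
  refine le_of_tendsto_of_tendsto
    ((MV_XT_tendsto hn d A hA (fun j => (hb j).subset (hAK j)) hdA).add
    (MV_XT_tendsto hn d B hB (fun j => (hb j).subset (hBK j)) hdB))
    (MV_XT_tendsto hn d K hK hb hdK) ?_
  filter_upwards [eventually_nonempty d A hAn hdA, eventually_nonempty d B hBn hdB] with m h1 h2
  exact superadd_fin hn (fun i : Fin m => d i) (fun j => {i | d i ∈ K j})
    (fun j => {i | d i ∈ A j}) (fun j => {i | d i ∈ B j}) (fun j i hi => hAK j hi)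
    (fun j i hi => hBK j hi) h1 h2 k c (fun j i hi => hAc j _ hi) (fun j i hi => hBc j _ hi)

end approx


section boxes
variable {n : ℕ}

/-- open box -/
def Box (l u : Fin n → ℝ) : Set (Fin n → ℝ) := Set.pi Set.univ fun k => Set.Ioo (l k) (u k)

lemma mem_Box {l u x : Fin n → ℝ} : x ∈ Box l u ↔ ∀ k, l k < x k ∧ x k < u k := by
  simp [Box]

lemma Box_convex (l u : Fin n → ℝ) : Convex ℝ (Box l u) :=
  convex_pi fun k _ => convex_Ioo (l k) (u k)

lemma Box_bounded (l u : Fin n → ℝ) : Bornology.IsBounded (Box l u) :=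
  Bornology.IsBounded.pi fun k => Metric.isBounded_Ioo (l k) (u k)

lemma Box_nonempty {l u : Fin n → ℝ} (h : ∀ k, l k < u k) : (Box l u).Nonempty :=
  ⟨fun k => (l k + u k) / 2, mem_Box.2 fun k => by have := h k; constructor <;> linarith⟩

lemma Box_add {l u l' u' : Fin n → ℝ} (h : ∀ k, l k < u k) (h' : ∀ k, l' k < u' k) :
    Box l u + Box l' u' = Box (l + l') (u + u') := by
  ext x
  rw [Set.mem_add]
  constructor
  · rintro ⟨y, hy, z, hz, rfl⟩
    rw [mem_Box] at *
    intro k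
    have := hy k
    have := hz k
    simp only [Pi.add_apply]
    constructor <;> linarith
  · intro hx
    rw [mem_Box] at hx
    set t : Fin n → ℝ := fun k => (x k - (l k + l' k)) / ((u k - l k) + (u' k - l' k)) with ht
    have hd : ∀ k, 0 < (u k - l k) + (u' k - l' k) := fun k => by
      have := h k; have := h' k; linarith
    have h0 : ∀ k, 0 < t k := fun k => by
      have := (hx k).1
      simp only [Pi.add_apply] at this
      exact div_pos (by linarith) (hd k)
    have h1 : ∀ k, t k < 1 := fun k => by
      have := (hx k).2
      simp only [Pi.add_apply] at this
      rw [ht, div_lt_one (hd k)]; linarith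
    refine ⟨fun k => l k + t k * (u k - l k), mem_Box.2 fun k => ?_,
      fun k => l' k + t k * (u' k - l' k), mem_Box.2 fun k => ?_, ?_⟩
    · have := h k; have := h0 k; have := h1 k
      constructor <;> nlinarith
    · have := h' k; have := h0 k; have := h1 k
      constructor <;> nlinarith
    · ext k
      have := (hd k).ne'
      simp only [Pi.add_apply, ht]
      field_simp
      ring

lemma vol_Box {l u : Fin n → ℝ} (h : ∀ k, l k < u k) : vol (Box l u) = ∏ k, (u k - l k) :=
  Real.volume_pi_Ioo_toReal fun k => (h k).le

lemma Box_sum (l u : Fin n → Fin n → ℝ) (h : ∀ j k, l j k < u j k) (S : Finset (Fin n))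
    (hS : S.Nonempty) : ∑ j ∈ S, Box (l j) (u j) = Box (∑ j ∈ S, l j) (∑ j ∈ S, u j) := by
  induction hS using Finset.Nonempty.cons_induction with
  | singleton a => simp
  | cons a S ha hS ih =>
    rw [Finset.sum_cons, Finset.sum_cons, Finset.sum_cons, ih, Box_add (h a)]
    intro k
    simp only [Finset.sum_apply]
    exact Finset.sum_lt_sum_of_nonempty hS fun j _ => h j k

lemma vol_Box_sum (hn : 1 ≤ n) (l u : Fin n → Fin n → ℝ) (h : ∀ j k, l j k < u j k)
    (S : Finset (Fin n)) :
    vol (∑ j ∈ S, Box (l j) (u j)) = ∏ k, ∑ j ∈ S, (u j k - l j k) := by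
  rcases S.eq_empty_or_nonempty with rfl | hS
  · have : Nonempty (Fin n) := ⟨⟨0, hn⟩⟩
    rw [Finset.sum_empty, vol, ← Set.singleton_zero, measure_singleton]
    rw [Finset.prod_eq_zero (Finset.mem_univ (⟨0, hn⟩ : Fin n)) (by simp)]
    simp
  · rw [Box_sum l u h S hS, vol_Box]
    · simp
    · intro k
      simp only [Finset.sum_apply]
      exact Finset.sum_lt_sum_of_nonempty hS fun j _ => h j k

lemma MV_Box (hn : 1 ≤ n) (l u : Fin n → Fin n → ℝ) (h : ∀ j k, l j k < u j k) :
    MV n (fun j => Box (l j) (u j)) = ∑ σ : Equiv.Perm (Fin n), ∏ k, (u (σ k) k - l (σ k) k) := by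
  classical
  rw [MV_eq hn]
  simp_rw [vol_Box_sum hn l u h]
  have h1 := incl_excl (n := n) (α := Fin n) id (fun f => ∏ k, (u (f k) k - l (f k) k))
  have h2 : ∀ S : Finset (Fin n), ∏ k, ∑ j ∈ S, (u j k - l j k)
      = ∑ f : Fin n → Fin n, if ∀ k, id (f k) ∈ S then ∏ k, (u (f k) k - l (f k) k) else 0 := by
    intro S
    rw [Finset.prod_univ_sum, ← Finset.sum_filter]
    refine Finset.sum_congr ?_ fun _ _ => rfl
    ext f; simp
  simp_rw [h2]
  convert h1 using 1
  rw [← Finset.sum_filter]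
  symm
  refine Finset.sum_bij' (fun f hf => Equiv.ofBijective f (Finset.mem_filter.1 hf).2)
    (fun σ _ => σ) ?_ ?_ ?_ ?_ ?_
  · simp
  · intro σ _
    simp only [Finset.mem_filter, Finset.mem_univ, true_and, Function.id_comp]
    exact σ.bijective
  · intro f _; rfl
  · intro σ _; ext; rfl
  · intro f _; rfl

lemma perm_ge (hn : 1 ≤ n) (a : Fin n → Fin n → ℝ) (ha : ∀ j k, 0 ≤ a j k) :
    (n.factorial : ℝ) * (∏ j, ∏ k, a j k) ^ (1 / (n : ℝ))
      ≤ ∑ σ : Equiv.Perm (Fin n), ∏ k, a (σ k) k := by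
  have : NeZero n := ⟨by omega⟩
  have hn0 : (0 : ℝ) < n := by exact_mod_cast hn
  have key : ∀ σ : Equiv.Perm (Fin n), (∏ j, ∏ k, a j k) ^ (1 / (n : ℝ))
      ≤ ∑ c : Fin n, (1 / (n : ℝ)) * ∏ k, a ((Equiv.addLeft c * σ) k) k := by
    intro σ
    have h := Real.geom_mean_le_arith_mean_weighted (Finset.univ : Finset (Fin n))
      (fun _ => 1 / (n : ℝ)) (fun c => ∏ k, a ((Equiv.addLeft c * σ) k) k)
      (fun _ _ => by positivity) (by simp)
      (fun c _ => Finset.prod_nonneg fun k _ => ha _ _)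
    refine le_trans (le_of_eq ?_) h
    rw [Real.finsetProd_rpow _ _ fun c _ => Finset.prod_nonneg fun k _ => ha _ _]
    congr 1
    rw [Finset.prod_comm, Finset.prod_comm (s := Finset.univ)]
    conv_rhs => rw [Finset.prod_comm]
    rw [Finset.prod_comm]
    refine Finset.prod_congr rfl fun k _ => ?_
    exact (Equiv.prod_comp (Equiv.addRight (σ k)) (fun j => a j k)).symm
  have h1 : ∑ σ : Equiv.Perm (Fin n), (∏ j, ∏ k, a j k) ^ (1 / (n : ℝ))
      = (n.factorial : ℝ) * (∏ j, ∏ k, a j k) ^ (1 / (n : ℝ)) := by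
    simp [Fintype.card_perm]
  rw [← h1]
  refine (Finset.sum_le_sum fun σ _ => key σ).trans (le_of_eq ?_)
  rw [Finset.sum_comm]
  have h2 : ∀ c : Fin n, ∑ σ : Equiv.Perm (Fin n),
      (1 / (n : ℝ)) * ∏ k, a ((Equiv.addLeft c * σ) k) k
      = (1 / (n : ℝ)) * ∑ σ : Equiv.Perm (Fin n), ∏ k, a (σ k) k := by
    intro c
    rw [← Finset.mul_sum]
    congr 1
    exact Equiv.sum_comp (Equiv.mulLeft (Equiv.addLeft c))
      (fun σ : Equiv.Perm (Fin n) => ∏ k, a (σ k) k)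
  simp_rw [h2]
  simp
  field_simp

/-- A finite family of boxes. -/
structure BF (n : ℕ) where
  s : Finset ℕ
  lo : ℕ → Fin n → ℝ
  hi : ℕ → Fin n → ℝ

namespace BF

def ok (F : BF n) : Prop := (∀ a ∈ F.s, ∀ k, F.lo a k < F.hi a k) ∧
  ∀ a ∈ F.s, ∀ b ∈ F.s, a ≠ b → ∃ k, F.hi a k ≤ F.lo b k ∨ F.hi b k ≤ F.lo a k

noncomputable def bvol (F : BF n) : ℝ := ∑ a ∈ F.s, ∏ k, (F.hi a k - F.lo a k)

noncomputable def left (F : BF n) (k : Fin n) (c : ℝ) : BF n where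
  s := F.s.filter fun a => F.lo a k < c
  lo := F.lo
  hi := fun a => Function.update (F.hi a) k (min (F.hi a k) c)

noncomputable def right (F : BF n) (k : Fin n) (c : ℝ) : BF n where
  s := F.s.filter fun a => c < F.hi a k
  lo := fun a => Function.update (F.lo a) k (max (F.lo a k) c)
  hi := F.hi

def hull (F : BF n) : Set (Fin n → ℝ) := convexHull ℝ (⋃ a ∈ F.s, Box (F.lo a) (F.hi a))

lemma bvol_pos {F : BF n} (h : F.ok) (hs : F.s.Nonempty) : 0 < F.bvol :=
  Finset.sum_pos (fun a ha => Finset.prod_pos fun k _ => sub_pos.2 (h.1 a ha k)) hs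

lemma nonempty_of_bvol {F : BF n} (h : 0 < F.bvol) : F.s.Nonempty := by
  by_contra hs
  rw [Finset.not_nonempty_iff_eq_empty] at hs
  simp [bvol, hs] at h

lemma left_hi_le (F : BF n) (k : Fin n) (c : ℝ) (a : ℕ) (k' : Fin n) :
    (F.left k c).hi a k' ≤ F.hi a k' := by
  simp only [left, Function.update_apply]
  split_ifs with h
  · subst h; exact min_le_left _ _
  · rfl

lemma right_lo_ge (F : BF n) (k : Fin n) (c : ℝ) (a : ℕ) (k' : Fin n) :
    F.lo a k' ≤ (F.right k c).lo a k' := by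
  simp only [right, Function.update_apply]
  split_ifs with h
  · subst h; exact le_max_left _ _
  · rfl

lemma left_ok {F : BF n} (h : F.ok) (k : Fin n) (c : ℝ) : (F.left k c).ok := by
  constructor
  · intro a ha k'
    have ha' := Finset.mem_filter.1 ha
    simp only [left, Function.update_apply]
    split_ifs with h'
    · subst h'; exact lt_min (h.1 a ha'.1 _) ha'.2
    · exact h.1 a ha'.1 _
  · intro a ha b hb hab
    obtain ⟨k', h'⟩ := h.2 a (Finset.mem_filter.1 ha).1 b (Finset.mem_filter.1 hb).1 hab
    exact ⟨k', h'.imp (fun h => (left_hi_le F k c a k').trans h)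
      (fun h => (left_hi_le F k c b k').trans h)⟩

lemma right_ok {F : BF n} (h : F.ok) (k : Fin n) (c : ℝ) : (F.right k c).ok := by
  constructor
  · intro a ha k'
    have ha' := Finset.mem_filter.1 ha
    simp only [right, Function.update_apply]
    split_ifs with h'
    · subst h'; exact max_lt (h.1 a ha'.1 _) ha'.2
    · exact h.1 a ha'.1 _
  · intro a ha b hb hab
    obtain ⟨k', h'⟩ := h.2 a (Finset.mem_filter.1 ha).1 b (Finset.mem_filter.1 hb).1 hab
    exact ⟨k', h'.imp (fun h => h.trans (right_lo_ge F k c b k'))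
      (fun h => h.trans (right_lo_ge F k c a k'))⟩

noncomputable def rest (F : BF n) (k : Fin n) (a : ℕ) : ℝ :=
  ∏ k' ∈ Finset.univ.erase k, (F.hi a k' - F.lo a k')

lemma bvol_eq (F : BF n) (k : Fin n) : F.bvol = ∑ a ∈ F.s, (F.hi a k - F.lo a k) * F.rest k a :=
  Finset.sum_congr rfl fun a _ => (Finset.mul_prod_erase _ _ (Finset.mem_univ k)).symm

lemma left_bvol (F : BF n) (k : Fin n) (c : ℝ) (h : F.ok) : (F.left k c).bvol
    = ∑ a ∈ F.s, max 0 (min (F.hi a k) c - F.lo a k) * F.rest k a := by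
  have hr : ∀ a, (F.left k c).rest k a = F.rest k a := by
    intro a
    refine Finset.prod_congr rfl fun k' hk' => ?_
    simp [left, Function.update_apply, Finset.ne_of_mem_erase hk']
  rw [bvol_eq _ k]
  simp only [hr]
  simp only [left, Function.update_self]
  rw [Finset.sum_filter]
  refine Finset.sum_congr rfl fun a ha => ?_
  have h1 := h.1 a ha k
  split_ifs with hc
  · rw [max_eq_right]
    exact sub_nonneg.2 (le_min h1.le hc.le)
  · rw [max_eq_left, zero_mul]
    rw [sub_nonpos]
    exact (min_le_right _ _).trans (not_lt.1 hc)

lemma right_bvol (F : BF n) (k : Fin n) (c : ℝ) (h : F.ok) : (F.right k c).bvol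
    = ∑ a ∈ F.s, max 0 (F.hi a k - max (F.lo a k) c) * F.rest k a := by
  have hr : ∀ a, (F.right k c).rest k a = F.rest k a := by
    intro a
    refine Finset.prod_congr rfl fun k' hk' => ?_
    simp [right, Function.update_apply, Finset.ne_of_mem_erase hk']
  rw [bvol_eq _ k]
  simp only [hr]
  simp only [right, Function.update_self]
  rw [Finset.sum_filter]
  refine Finset.sum_congr rfl fun a ha => ?_
  have h1 := h.1 a ha k
  split_ifs with hc
  · rw [max_eq_right (sub_nonneg.2 (max_le h1.le hc.le))]
  · rw [max_eq_left (sub_nonpos.2 ((not_lt.1 hc).trans (le_max_right _ _))), zero_mul]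

lemma split (F : BF n) (k : Fin n) (c : ℝ) (h : F.ok) :
    (F.left k c).bvol + (F.right k c).bvol = F.bvol := by
  rw [left_bvol F k c h, right_bvol F k c h, bvol_eq F k, ← Finset.sum_add_distrib]
  refine Finset.sum_congr rfl fun a ha => ?_
  rw [← add_mul]
  congr 1
  have h1 := h.1 a ha k
  rcases le_total c (F.lo a k) with h2 | h2
  · rw [max_eq_left h2, min_eq_right (h2.trans h1.le), max_eq_left (by linarith),
      max_eq_right (by linarith)]; ring
  · rcases le_total c (F.hi a k) with h3 | h3
    · rw [max_eq_right h2, min_eq_right h3, max_eq_right (by linarith),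
        max_eq_right (by linarith)]; ring
    · rw [max_eq_right h2, min_eq_left h3, max_eq_right (by linarith),
        max_eq_left (by linarith)]; ring

lemma exists_cut (F : BF n) (k : Fin n) (h : F.ok) (t : ℝ) (h0 : 0 ≤ t) (h1 : t ≤ F.bvol) :
    ∃ c, (F.left k c).bvol = t := by
  have hc : Continuous fun c => (F.left k c).bvol := by
    simp_rw [left_bvol F k _ h]
    fun_prop
  refine mem_range_of_exists_le_of_exists_ge hc ?_ ?_
  · obtain ⟨m, hm⟩ := (F.s.finite_toSet.image (fun a => F.lo a k)).bddBelow
    refine ⟨m, ?_⟩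
    have : (F.left k m).bvol = 0 := by
      rw [left_bvol F k _ h]
      refine Finset.sum_eq_zero fun a ha => ?_
      have : m ≤ F.lo a k := hm ⟨a, ha, rfl⟩
      rw [max_eq_left, zero_mul]
      rw [sub_nonpos]
      exact (min_le_right _ _).trans this
    rw [this]; exact h0
  · obtain ⟨m, hm⟩ := (F.s.finite_toSet.image (fun a => F.hi a k)).bddAbove
    refine ⟨m, ?_⟩
    have : (F.left k m).bvol = F.bvol := by
      rw [left_bvol F k _ h, bvol_eq F k]
      refine Finset.sum_congr rfl fun a ha => ?_
      have h2 : F.hi a k ≤ m := hm ⟨a, ha, rfl⟩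
      have h3 := h.1 a ha k
      rw [min_eq_left h2, max_eq_right (by linarith)]
    rw [this]; exact h1

lemma hull_convex (F : BF n) : Convex ℝ F.hull := convex_convexHull ℝ _

lemma box_subset_hull (F : BF n) {a : ℕ} (ha : a ∈ F.s) : Box (F.lo a) (F.hi a) ⊆ F.hull :=
  (Set.subset_biUnion_of_mem (u := fun a => Box (F.lo a) (F.hi a)) ha).trans
    (subset_convexHull ℝ _)

lemma hull_subset (F : BF n) {K : Set (Fin n → ℝ)} (hK : Convex ℝ K)
    (h : ∀ a ∈ F.s, Box (F.lo a) (F.hi a) ⊆ K) : F.hull ⊆ K :=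
  convexHull_min (Set.iUnion₂_subset h) hK

lemma left_box_subset (F : BF n) (k : Fin n) (c : ℝ) (a : ℕ) :
    Box ((F.left k c).lo a) ((F.left k c).hi a) ⊆ Box (F.lo a) (F.hi a) := by
  intro x hx
  rw [mem_Box] at *
  exact fun k' => ⟨(hx k').1, (hx k').2.trans_le (left_hi_le F k c a k')⟩

lemma right_box_subset (F : BF n) (k : Fin n) (c : ℝ) (a : ℕ) :
    Box ((F.right k c).lo a) ((F.right k c).hi a) ⊆ Box (F.lo a) (F.hi a) := by
  intro x hx
  rw [mem_Box] at *
  exact fun k' => ⟨(right_lo_ge F k c a k').trans_lt (hx k').1, (hx k').2⟩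

lemma left_hull_subset (F : BF n) (k : Fin n) (c : ℝ) : (F.left k c).hull ⊆ F.hull :=
  hull_subset _ F.hull_convex fun a ha => (left_box_subset F k c a).trans
    (box_subset_hull F (Finset.mem_filter.1 ha).1)

lemma right_hull_subset (F : BF n) (k : Fin n) (c : ℝ) : (F.right k c).hull ⊆ F.hull :=
  hull_subset _ F.hull_convex fun a ha => (right_box_subset F k c a).trans
    (box_subset_hull F (Finset.mem_filter.1 ha).1)

lemma left_hull_lt (F : BF n) (k : Fin n) (c : ℝ) : ∀ x ∈ (F.left k c).hull, x k < c := by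
  have hc : Convex ℝ {x : Fin n → ℝ | x k < c} :=
    convex_halfSpace_lt (LinearMap.proj (R := ℝ) (φ := fun _ : Fin n => ℝ) k).isLinear c
  refine hull_subset _ hc fun a _ x hx => ?_
  have := (mem_Box.1 hx k).2
  simp only [left, Function.update_self] at this
  exact this.trans_le (min_le_right _ _)

lemma right_hull_gt (F : BF n) (k : Fin n) (c : ℝ) : ∀ x ∈ (F.right k c).hull, c < x k := by
  have hc : Convex ℝ {x : Fin n → ℝ | c < x k} :=
    convex_halfSpace_gt (LinearMap.proj (R := ℝ) (φ := fun _ : Fin n => ℝ) k).isLinear c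
  refine hull_subset _ hc fun a _ x hx => ?_
  have := (mem_Box.1 hx k).1
  simp only [right, Function.update_self] at this
  exact (le_max_right _ _).trans_lt this

lemma hull_nonempty {F : BF n} (h : F.ok) (hs : F.s.Nonempty) : F.hull.Nonempty := by
  obtain ⟨a, ha⟩ := hs
  exact (Box_nonempty (h.1 a ha)).mono (box_subset_hull F ha)

lemma hull_bounded (F : BF n) : Bornology.IsBounded F.hull := by
  refine isBounded_convexHull.2 ?_
  exact (Bornology.isBounded_biUnion F.s.finite_toSet).2 fun a _ => Box_bounded _ _

lemma step (hn : 1 ≤ n) (F : Fin n → BF n) (hF : ∀ j, (F j).ok) (hs : ∀ j, (F j).s.Nonempty)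
    (K : Fin n → Set (Fin n → ℝ)) (hK : ∀ j, Convex ℝ (K j))
    (hb : ∀ j, Bornology.IsBounded (K j)) (hFK : ∀ j, (F j).hull ⊆ K j)
    (k : Fin n) (c : Fin n → ℝ) (t : ℝ) (ht0 : 0 < t) (ht1 : t < 1)
    (hc : ∀ j, ((F j).left k (c j)).bvol = t * (F j).bvol)
    (hL : (n.factorial : ℝ) * (∏ j, ((F j).left k (c j)).bvol) ^ (1 / (n : ℝ))
      ≤ MV n fun j => ((F j).left k (c j)).hull)
    (hR : (n.factorial : ℝ) * (∏ j, ((F j).right k (c j)).bvol) ^ (1 / (n : ℝ))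
      ≤ MV n fun j => ((F j).right k (c j)).hull) :
    (n.factorial : ℝ) * (∏ j, (F j).bvol) ^ (1 / (n : ℝ)) ≤ MV n K := by
  have hn0 : (n : ℝ) ≠ 0 := by positivity
  have hpos : ∀ j, 0 < (F j).bvol := fun j => bvol_pos (hF j) (hs j)
  have hc' : ∀ j, ((F j).right k (c j)).bvol = (1 - t) * (F j).bvol := fun j => by
    have := split (F j) k (c j) (hF j)
    rw [hc] at this; linarith
  have hLn : ∀ j, ((F j).left k (c j)).s.Nonempty := fun j => nonempty_of_bvol (by
    rw [hc]; exact mul_pos ht0 (hpos j))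
  have hRn : ∀ j, ((F j).right k (c j)).s.Nonempty := fun j => nonempty_of_bvol (by
    rw [hc']; exact mul_pos (by linarith) (hpos j))
  have hP : 0 ≤ ∏ j, (F j).bvol := Finset.prod_nonneg fun j _ => (hpos j).le
  have hpow : ∀ r : ℝ, 0 ≤ r → (∏ j, (r * (F j).bvol)) ^ (1 / (n : ℝ))
      = r * (∏ j, (F j).bvol) ^ (1 / (n : ℝ)) := by
    intro r hr
    rw [Finset.prod_mul_distrib, Finset.prod_const, Finset.card_univ, Fintype.card_fin,
      Real.mul_rpow (by positivity) hP, ← Real.rpow_natCast, ← Real.rpow_mul hr,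
      mul_one_div_cancel hn0, Real.rpow_one]
  simp only [hc] at hL
  simp only [hc'] at hR
  rw [hpow t ht0.le] at hL
  rw [hpow (1 - t) (by linarith)] at hR
  have := superadd hn K (fun j => ((F j).left k (c j)).hull) (fun j => ((F j).right k (c j)).hull)
    hK (fun j => hull_convex _) (fun j => hull_convex _) hb
    (fun j => (left_hull_subset _ _ _).trans (hFK j))
    (fun j => (right_hull_subset _ _ _).trans (hFK j))
    (fun j => hull_nonempty (left_ok (hF j) _ _) (hLn j))
    (fun j => hull_nonempty (right_ok (hF j) _ _) (hRn j)) k c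
    (fun j => left_hull_lt _ _ _) (fun j => right_hull_gt _ _ _)
  linarith

lemma single (hn : 1 ≤ n) (F : Fin n → BF n) (hF : ∀ j, (F j).ok) (hs : ∀ j, (F j).s.Nonempty)
    (h1 : ∀ j, #(F j).s ≤ 1) : (n.factorial : ℝ) * (∏ j, (F j).bvol) ^ (1 / (n : ℝ))
      ≤ MV n fun j => (F j).hull := by
  have h2 : ∀ j, ∃ a, (F j).s = {a} := fun j =>
    Finset.card_eq_one.1 (le_antisymm (h1 j) (hs j).card_pos)
  choose a ha using h2
  have h3 : ∀ j, (F j).hull = Box ((F j).lo (a j)) ((F j).hi (a j)) := by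
    intro j
    simp only [hull, ha, Finset.mem_singleton, Set.iUnion_iUnion_eq_left]
    exact (Box_convex _ _).convexHull_eq
  have h4 : ∀ j, (F j).bvol = ∏ k, ((F j).hi (a j) k - (F j).lo (a j) k) := by
    intro j; simp [bvol, ha]
  have h5 : ∀ j k, (F j).lo (a j) k < (F j).hi (a j) k := fun j k =>
    (hF j).1 _ (by simp [ha]) k
  simp only [h3, h4]
  rw [MV_Box hn _ _ h5]
  exact perm_ge hn (fun j k => (F j).hi (a j) k - (F j).lo (a j) k)
    fun j k => sub_nonneg.2 (h5 j k).le

theorem main (hn : 1 ≤ n) (N : ℕ) : ∀ (F : Fin n → BF n), (∀ j, (F j).ok) →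
    (∀ j, (F j).s.Nonempty) → ∑ j, #(F j).s ≤ N →
    ∀ (K : Fin n → Set (Fin n → ℝ)), (∀ j, Convex ℝ (K j)) →
    (∀ j, Bornology.IsBounded (K j)) → (∀ j, (F j).hull ⊆ K j) →
    (n.factorial : ℝ) * (∏ j, (F j).bvol) ^ (1 / (n : ℝ)) ≤ MV n K := by
  induction N with
  | zero =>
    intro F hF hs hN
    exfalso
    have : #(F ⟨0, hn⟩).s ≤ ∑ j, #(F j).s :=
      Finset.single_le_sum (f := fun j => #(F j).s) (fun _ _ => Nat.zero_le _) (Finset.mem_univ _)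
    have := (hs ⟨0, hn⟩).card_pos
    omega
  | succ N ih =>
    intro F hF hs hN K hK hb hFK
    have hpos : ∀ j, 0 < (F j).bvol := fun j => bvol_pos (hF j) (hs j)
    by_cases h1 : ∀ j, #(F j).s ≤ 1
    · have hcut : ∀ j, ∃ c, ((F j).left ⟨0, hn⟩ c).bvol = (1 / 2) * (F j).bvol := fun j =>
        exists_cut (F j) _ (hF j) _ (by have := hpos j; linarith) (by have := hpos j; linarith)
      choose c hc using hcut
      refine step hn F hF hs K hK hb hFK ⟨0, hn⟩ c (1 / 2) (by norm_num) (by norm_num) hc ?_ ?_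
      · refine single hn _ (fun j => left_ok (hF j) _ _) (fun j => nonempty_of_bvol ?_)
          fun j => (Finset.card_filter_le _ _).trans (h1 j)
        rw [hc]; have := hpos j; linarith
      · refine single hn _ (fun j => right_ok (hF j) _ _) (fun j => nonempty_of_bvol ?_)
          fun j => (Finset.card_filter_le _ _).trans (h1 j)
        have := split (F j) ⟨0, hn⟩ (c j) (hF j)
        rw [hc] at this; have := hpos j; linarith
    · push Not at h1
      obtain ⟨j₀, hj₀⟩ := h1
      have hsep : ∃ a ∈ (F j₀).s, ∃ b ∈ (F j₀).s, ∃ k, (F j₀).hi a k ≤ (F j₀).lo b k := by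
        obtain ⟨a, ha, b, hb, hab⟩ := Finset.one_lt_card.1 hj₀
        obtain ⟨k, h | h⟩ := (hF j₀).2 a ha b hb hab
        · exact ⟨a, ha, b, hb, k, h⟩
        · exact ⟨b, hb, a, ha, k, h⟩
      obtain ⟨a, ha, b, hb', k, hk⟩ := hsep
      set c₀ := (F j₀).hi a k with hc₀
      have haL : a ∈ ((F j₀).left k c₀).s := Finset.mem_filter.2 ⟨ha, (hF j₀).1 a ha k⟩
      have hbR : b ∈ ((F j₀).right k c₀).s :=
        Finset.mem_filter.2 ⟨hb', hk.trans_lt ((hF j₀).1 b hb' k)⟩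
      have hbL : b ∉ ((F j₀).left k c₀).s := fun h =>
        absurd (Finset.mem_filter.1 h).2 (not_lt.2 hk)
      have haR : a ∉ ((F j₀).right k c₀).s := fun h =>
        absurd (Finset.mem_filter.1 h).2 (lt_irrefl _)
      have hLp := bvol_pos (left_ok (hF j₀) k c₀) ⟨a, haL⟩
      have hRp := bvol_pos (right_ok (hF j₀) k c₀) ⟨b, hbR⟩
      have hsp := split (F j₀) k c₀ (hF j₀)
      set t := ((F j₀).left k c₀).bvol / (F j₀).bvol with ht
      have ht0 : 0 < t := div_pos hLp (hpos j₀)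
      have ht1 : t < 1 := (div_lt_one (hpos j₀)).2 (by linarith)
      have hcut : ∀ j, ∃ c, ((F j).left k c).bvol = t * (F j).bvol ∧ (j = j₀ → c = c₀) := by
        intro j
        by_cases hj : j = j₀
        · subst hj
          exact ⟨c₀, by rw [ht, div_mul_cancel₀ _ (hpos j).ne'], fun _ => rfl⟩
        · obtain ⟨c, hc⟩ := exists_cut (F j) k (hF j) (t * (F j).bvol)
            (mul_pos ht0 (hpos j)).le (by have := hpos j; nlinarith)
          exact ⟨c, hc, fun h => absurd h hj⟩
      choose c hc hcj using hcut
      have hcj₀ : c j₀ = c₀ := hcj j₀ rfl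
      refine step hn F hF hs K hK hb hFK k c t ht0 ht1 hc ?_ ?_
      · refine ih _ (fun j => left_ok (hF j) _ _) (fun j => nonempty_of_bvol ?_) ?_ _
          (fun j => hull_convex _) (fun j => hull_bounded _) (fun j => subset_rfl)
        · rw [hc]; exact mul_pos ht0 (hpos j)
        · have : ∑ j, #((F j).left k (c j)).s < ∑ j, #(F j).s := by
            refine Finset.sum_lt_sum (fun j _ => Finset.card_filter_le _ _)
              ⟨j₀, Finset.mem_univ _, ?_⟩
            rw [hcj₀]
            exact Finset.card_lt_card (Finset.filter_ssubset.2 ⟨b, hb', not_lt.2 hk⟩)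
          omega
      · refine ih _ (fun j => right_ok (hF j) _ _) (fun j => nonempty_of_bvol ?_) ?_ _
          (fun j => hull_convex _) (fun j => hull_bounded _) (fun j => subset_rfl)
        · have := split (F j) k (c j) (hF j)
          rw [hc] at this; have := hpos j; nlinarith
        · have : ∑ j, #((F j).right k (c j)).s < ∑ j, #(F j).s := by
            refine Finset.sum_lt_sum (fun j _ => Finset.card_filter_le _ _)
              ⟨j₀, Finset.mem_univ _, ?_⟩
            rw [hcj₀]
            exact Finset.card_lt_card (Finset.filter_ssubset.2 ⟨a, ha, lt_irrefl _⟩)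
          omega

end BF
end boxes


section final
variable {n : ℕ}

lemma exists_BF (K : Set (Fin n → ℝ)) (hK : Convex ℝ K) (hb : Bornology.IsBounded K)
    (c : ℝ) (hc0 : 0 ≤ c) (hc : c < vol K) :
    ∃ F : BF n, F.ok ∧ F.s.Nonempty ∧ F.hull ⊆ K ∧ c < F.bvol := by
  have hfin : volume K ≠ ⊤ := hb.measure_lt_top.ne
  obtain ⟨t, r, htc, hts, htr, hcov, hdisj⟩ :=
    Besicovitch.exists_disjoint_closedBall_covering_ae (volume : Measure (Fin n → ℝ))
      (fun x => {r | Metric.closedBall x r ⊆ K}) (interior K) (by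
        intro x hx δ hδ
        obtain ⟨ε, hε, h⟩ := Metric.isOpen_iff.1 isOpen_interior x hx
        refine ⟨min (ε / 2) (δ / 2), ?_, by positivity, ?_⟩
        · refine (Metric.closedBall_subset_ball ?_).trans (h.trans interior_subset)
          exact (min_le_left _ _).trans_lt (by linarith)
        · exact (min_le_right _ _).trans_lt (by linarith)) (fun _ => 1) (fun _ _ => one_pos)
  have h1 : volume K ≤ ∑' x : t, volume (Metric.closedBall (x : Fin n → ℝ) (r x)) := by
    rw [← convex_volume_interior hK]
    calc volume (interior K) ≤ volume ((interior K \ ⋃ x ∈ t, Metric.closedBall x (r x)) ∪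
          ⋃ x ∈ t, Metric.closedBall x (r x)) := by
          refine measure_mono fun y hy => ?_
          by_cases h : y ∈ ⋃ x ∈ t, Metric.closedBall x (r x)
          · exact Or.inr h
          · exact Or.inl ⟨hy, h⟩
      _ ≤ 0 + volume (⋃ x ∈ t, Metric.closedBall x (r x)) := by
          rw [← hcov]; exact measure_union_le _ _
      _ ≤ _ := by rw [zero_add]; exact measure_biUnion_le _ htc _
  have h2 : ENNReal.ofReal c < volume K := by
    rw [ENNReal.ofReal_lt_iff_lt_toReal hc0 hfin]; exact hc
  replace h2 := h2.trans_le h1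
  rw [ENNReal.tsum_eq_iSup_sum, lt_iSup_iff] at h2
  obtain ⟨u, hu⟩ := h2
  letI : Encodable t := htc.toEncodable
  have hrpos : ∀ x : t, 0 < r x := fun x => (htr x x.2).2.1
  let F : BF n :=
    { s := u.map ⟨Encodable.encode, Encodable.encode_injective⟩
      lo := fun a k => ((Encodable.decode (α := t) a).elim 0 fun x => (x : Fin n → ℝ) k - r x)
      hi := fun a k => ((Encodable.decode (α := t) a).elim 0 fun x => (x : Fin n → ℝ) k + r x) }
  have hlo : ∀ (x : t) k, F.lo (Encodable.encode x) k = (x : Fin n → ℝ) k - r x := by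
    intro x k; simp [F, Encodable.encodek]
  have hhi : ∀ (x : t) k, F.hi (Encodable.encode x) k = (x : Fin n → ℝ) k + r x := by
    intro x k; simp [F, Encodable.encodek]
  have hs : ∀ a ∈ F.s, ∃ x ∈ u, a = Encodable.encode x := by
    intro a ha
    obtain ⟨x, hx, rfl⟩ := Finset.mem_map.1 ha
    exact ⟨x, hx, rfl⟩
  have hmem : ∀ (x : t) (y : Fin n → ℝ), y ∈ Metric.closedBall (x : Fin n → ℝ) (r x) ↔
      ∀ k, (x : Fin n → ℝ) k - r x ≤ y k ∧ y k ≤ (x : Fin n → ℝ) k + r x := by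
    intro x y
    rw [Metric.mem_closedBall, dist_pi_le_iff (hrpos x).le]
    refine forall_congr' fun k => ?_
    rw [Real.dist_eq, abs_le]
    constructor <;> rintro ⟨h, h'⟩ <;> constructor <;> linarith
  have hbv : F.bvol = ∑ x ∈ u, (2 * r x) ^ n := by
    rw [BF.bvol, Finset.sum_map]
    refine Finset.sum_congr rfl fun x _ => ?_
    simp only [Function.Embedding.coeFn_mk, hlo, hhi]
    rw [Finset.prod_congr rfl (fun k _ => show (x : Fin n → ℝ) k + r x - ((x : Fin n → ℝ) k - r x)
      = 2 * r x by ring)]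
    simp
  have hcb : c < F.bvol := by
    rw [hbv]
    have h3 : ∑ x ∈ u, volume (Metric.closedBall (x : Fin n → ℝ) (r x))
        = ENNReal.ofReal (∑ x ∈ u, (2 * r x) ^ n) := by
      rw [ENNReal.ofReal_sum_of_nonneg fun x _ => by have := hrpos x; positivity]
      refine Finset.sum_congr rfl fun x _ => ?_
      rw [Real.volume_pi_closedBall _ (hrpos x).le]
      simp
    rw [h3] at hu
    exact (ENNReal.ofReal_lt_ofReal_iff_of_nonneg hc0).1 hu
  refine ⟨F, ⟨?_, ?_⟩, BF.nonempty_of_bvol (hc0.trans_lt hcb), ?_, hcb⟩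
  · intro a ha k
    obtain ⟨x, hx, rfl⟩ := hs a ha
    rw [hlo, hhi]
    have := hrpos x
    linarith
  · intro a ha b hb' hab
    obtain ⟨x, hx, rfl⟩ := hs a ha
    obtain ⟨y, hy, rfl⟩ := hs b hb'
    have hxy : (x : Fin n → ℝ) ≠ y := fun h => hab (by rw [Subtype.ext h])
    have hd := hdisj x.2 y.2 hxy
    by_contra hcon
    push Not at hcon
    simp only [hlo, hhi] at hcon
    have hmx : (fun k => max ((x : Fin n → ℝ) k - r x) ((y : Fin n → ℝ) k - r y)) ∉
        Metric.closedBall (y : Fin n → ℝ) (r y) := by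
      refine Set.disjoint_left.1 hd ((hmem x _).2 fun k => ?_)
      have := hcon k
      have := hrpos x
      exact ⟨le_max_left _ _, max_le (by linarith) (by linarith)⟩
    refine hmx ((hmem y _).2 fun k => ?_)
    · have := hcon k
      have := hrpos y
      exact ⟨le_max_right _ _, max_le (by linarith) (by linarith)⟩
  · refine BF.hull_subset F hK fun a ha => ?_
    obtain ⟨x, hx, rfl⟩ := hs a ha
    refine Set.Subset.trans ?_ (htr x x.2).1
    intro y hy
    rw [mem_Box] at hy
    refine (hmem x y).2 fun k => ?_
    have := hy k
    rw [hlo, hhi] at this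
    exact ⟨this.1.le, this.2.le⟩

lemma MV_ge (hn : 1 ≤ n) (K : Fin n → Set (Fin n → ℝ))
    (hK : ∀ j, Convex ℝ (K j)) (hb : ∀ j, Bornology.IsBounded (K j))
    (hne : ∀ j, (K j).Nonempty) :
    (n.factorial : ℝ) ^ n * ∏ j, vol (K j) ≤ MV n K ^ n := by
  have h0 := MV_nonneg hn K hK hb hne
  have hn0 : n ≠ 0 := by omega
  by_cases hz : ∀ j, 0 < vol (K j)
  · have key : ∀ θ ∈ Set.Ioo (0 : ℝ) 1,
        (n.factorial : ℝ) ^ n * ∏ j, (θ * vol (K j)) ≤ MV n K ^ n := by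
      intro θ hθ
      have hF := fun j => exists_BF (K j) (hK j) (hb j) (θ * vol (K j))
        (mul_nonneg hθ.1.le (hz j).le) (by nlinarith [hz j, hθ.2])
      choose F hok hs hh hv using hF
      have h1 := BF.main hn _ F hok hs le_rfl K hK hb hh
      have hp : 0 ≤ ∏ j, (F j).bvol := Finset.prod_nonneg fun j _ => (BF.bvol_pos (hok j) (hs j)).le
      have h2 := pow_le_pow_left₀ (by positivity) h1 n
      rw [mul_pow, one_div, Real.rpow_inv_natCast_pow hp hn0] at h2
      refine le_trans ?_ h2
      gcongr with j
      · exact fun j _ => mul_nonneg hθ.1.le (hz j).le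
      · exact (hv j).le
    have hlim : Filter.Tendsto (fun θ : ℝ => (n.factorial : ℝ) ^ n * ∏ j, (θ * vol (K j)))
        (nhdsWithin 1 (Set.Iio 1)) (nhds ((n.factorial : ℝ) ^ n * ∏ j, (1 * vol (K j)))) := by
      refine Filter.Tendsto.mono_left (Continuous.tendsto ?_ 1) nhdsWithin_le_nhds
      fun_prop
    simp only [one_mul] at hlim
    refine le_of_tendsto hlim ?_
    filter_upwards [Ioo_mem_nhdsLT (show (0 : ℝ) < 1 from one_pos)] with θ hθ
    exact key θ hθ
  · push Not at hz
    obtain ⟨j, hj⟩ := hz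
    have : vol (K j) = 0 := le_antisymm hj ENNReal.toReal_nonneg
    rw [Finset.prod_eq_zero (Finset.mem_univ j) this, mul_zero]
    positivity

lemma prod_ite_lt {i : ℕ} (hin : i ≤ n) (a b : ℝ) :
    ∏ j : Fin n, (if (j : ℕ) < i then a else b) = a ^ i * b ^ (n - i) := by
  rw [Fin.prod_univ_eq_prod_range (fun j => if j < i then a else b) n]
  obtain ⟨m, rfl⟩ := Nat.exists_eq_add_of_le hin
  rw [Finset.prod_range_add]
  congr 1
  · rw [Finset.prod_congr rfl fun j hj => if_pos (Finset.mem_range.1 hj)]; simp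
  · simp

end final

/-- Corollary 7.4(2): for nonempty compact convex sets `K, L ⊆ ℝⁿ` and `1 ≤ i ≤ n`,
`MV(K^{(i)}, L^{(n−i)})^n ≥ (n! · vol(K))^i · (n! · vol(L))^{n−i}`. -/
theorem hodge_corollary_two {n i : ℕ} (hi : 1 ≤ i) (hin : i ≤ n)
    (K L : Set (Fin n → ℝ))
    (hKne : K.Nonempty) (hKc : IsCompact K) (hKcv : Convex ℝ K)
    (hLne : L.Nonempty) (hLc : IsCompact L) (hLcv : Convex ℝ L) :
    MV n (fun j => if (j : ℕ) < i then K else L) ^ n ≥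
      ((n.factorial : ℝ) * vol K) ^ i * ((n.factorial : ℝ) * vol L) ^ (n - i) := by
  have h := MV_ge (hi.trans hin) (fun j : Fin n => if (j : ℕ) < i then K else L)
    (fun j => by split_ifs <;> assumption)
    (fun j => by split_ifs; exacts [hKc.isBounded, hLc.isBounded])
    (fun j => by split_ifs <;> assumption)
  refine le_trans (le_of_eq ?_) h
  rw [← prod_ite_lt hin]
  have h1 : (n.factorial : ℝ) ^ n = ∏ _j : Fin n, (n.factorial : ℝ) := by simp
  rw [h1, ← Finset.prod_mul_distrib]
  refine Finset.prod_congr rfl fun j _ => ?_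
  split_ifs <;> rfl
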